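/- arXiv:2512.23651 — 2 statements merged into one kernel-verified Lean document; each statement's English description precedes it below -/
import Mathlib

section
/- Let d ≥ 2, let K be an o-symmetric convex body in ℝ^d, and suppose there exists r > 0 such that K slides freely inside a Euclidean ball of radius r, i.e., for every boundary point x of K there is a point c ∈ ℝ^d with ‖x − c‖ = r and K ⊆ B̄(c, r) (this holds in particular when the boundary of K is of class C² with strictly positive Gaussian curvature everywhere). Fix n ≥ 2 and τ₁, …, τₙ > 0. Then there exist constants C > 0 and D > 0, depending only on τ₁, …, τₙ and K, with the following property: if p₁, …, pₙ ∈ ℝ^d are such that ℱ = {pᵢ + τᵢK : i = 1, …, n} is a non-separable family, and 0 < ε ≤ D is such that the K-circumradius of ⋃ℱ is at least (Σᵢ₌₁ⁿ τᵢ) − ε (i.e., whenever ⋃ℱ ⊆ x + λK for some x ∈ ℝ^d and λ > 0, one has λ ≥ (Σᵢ τᵢ) − ε), then there exists a straight line L ⊆ ℝ^d such that dist(pᵢ, L) ≤ C·ε^{1/2} for every i = 1, …, n. -/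
open Set Metric Pointwise MeasureTheory

noncomputable section

abbrev Euc (d : ℕ) := EuclideanSpace ℝ (Fin d)

variable {d : ℕ}

/-- A convex body: compact, convex, with nonempty interior. -/
def IsConvexBody (K : Set (Euc d)) : Prop :=
  IsCompact K ∧ Convex ℝ K ∧ (interior K).Nonempty

/-- A hyperplane of `ℝ^d`. -/
def IsHyperplane (H : Set (Euc d)) : Prop :=
  ∃ u : Euc d, u ≠ 0 ∧ ∃ c : ℝ, H = {x : Euc d | (inner ℝ x u : ℝ) = c}

/-- A straight line in `ℝ^d`. -/
def IsLine (L : Set (Euc d)) : Prop :=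
  ∃ p v : Euc d, v ≠ 0 ∧ L = {x : Euc d | ∃ t : ℝ, x = p + t • v}

/-- A `d`-polytope: convex hull of finitely many points, with nonempty interior. -/
def IsPolytope (P : Set (Euc d)) : Prop :=
  ∃ S : Finset (Euc d), P = convexHull ℝ (S : Set (Euc d)) ∧ (interior P).Nonempty

/-- A `d`-simplex: convex hull of `d+1` affinely independent points. -/
def IsSimplex (d : ℕ) (T : Set (Euc d)) : Prop :=
  ∃ v : Fin (d + 1) → Euc d, AffineIndependent ℝ v ∧ T = convexHull ℝ (Set.range v)

/-- The exposed face of `P` in direction `u`. -/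
def exposedFaceAt (P : Set (Euc d)) (u : Euc d) : Set (Euc d) :=
  {x ∈ P | ∀ y ∈ P, (inner ℝ y u : ℝ) ≤ (inner ℝ x u : ℝ)}

/-- `u` is the outer unit normal vector of a facet of `P`. -/
def IsFacetNormal (P : Set (Euc d)) (u : Euc d) : Prop :=
  ‖u‖ = 1 ∧ Module.finrank ℝ (affineSpan ℝ (exposedFaceAt P u)).direction = d - 1

/-- The hyperplane `H` is parallel to some facet of `P`:
some translate of `H` contains the facet. -/
def HypParallelToFacet (P H : Set (Euc d)) : Prop :=
  ∃ u : Euc d, IsFacetNormal P u ∧ ∃ v : Euc d, exposedFaceAt P u ⊆ (fun x => v + x) '' H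

/-- The positive homothet `x + τ • P`. -/
def homo (x : Euc d) (τ : ℝ) (P : Set (Euc d)) : Set (Euc d) := {x} + τ • P

/-- A weakly non-separable family of positive homothets of the polytope `P`. -/
def WNS (P : Set (Euc d)) {n : ℕ} (x : Fin n → Euc d) (τ : Fin n → ℝ) : Prop :=
  ∀ H : Set (Euc d), IsHyperplane H → HypParallelToFacet P H →
    (H ∩ convexHull ℝ (⋃ i, homo (x i) (τ i) P)).Nonempty →
    ∃ i, (H ∩ homo (x i) (τ i) P).Nonempty

/-- A non-separable family of convex bodies. -/
def NS {n : ℕ} (F : Fin n → Set (Euc d)) : Prop :=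
  ∀ H : Set (Euc d), IsHyperplane H →
    (H ∩ convexHull ℝ (⋃ i, F i)).Nonempty → ∃ i, (H ∩ F i).Nonempty

/-- `A` is a `k`-dimensional affine subspace of `ℝ^d` (as a set). -/
def IsAffSub (k : ℕ) (A : Set (Euc d)) : Prop :=
  ∃ S : AffineSubspace ℝ (Euc d), (S : Set (Euc d)) = A ∧ A.Nonempty ∧
    Module.finrank ℝ S.direction = k

/-- The affine subspace `A` is parallel to some facet of `P`:
some translate of `A` is contained in the affine hull of the facet. -/
def SubParallelToFacet (P A : Set (Euc d)) : Prop :=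
  ∃ u : Euc d, IsFacetNormal P u ∧ ∃ v : Euc d,
    (fun x => v + x) '' A ⊆ (affineSpan ℝ (exposedFaceAt P u) : Set (Euc d))

/-- A weakly `k`-impassable family of positive homothets of the polytope `P`. -/
def WIP (k : ℕ) (P : Set (Euc d)) {n : ℕ} (x : Fin n → Euc d) (τ : Fin n → ℝ) : Prop :=
  ∀ A : Set (Euc d), IsAffSub k A → SubParallelToFacet P A →
    (A ∩ convexHull ℝ (⋃ i, homo (x i) (τ i) P)).Nonempty →
    ∃ i, (A ∩ homo (x i) (τ i) P).Nonempty

/-- A full-rank lattice in `ℝ^d`. -/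
def IsFullLattice (L : Set (Euc d)) : Prop :=
  ∃ b : Module.Basis (Fin d) ℝ (Euc d),
    L = Set.range fun z : Fin d → ℤ => ∑ i, (z i : ℝ) • b i

/-- The integer lattice `ℤ^d` as a subset of `ℝ^d`. -/
def intLattice (d : ℕ) : Set (Euc d) := {x : Euc d | ∀ i, ∃ z : ℤ, x i = (z : ℝ)}

/-- The unit cube `[0,1]^d`. -/
def unitCube (d : ℕ) : Set (Euc d) := {x : Euc d | ∀ i, x i ∈ Set.Icc (0 : ℝ) 1}

/-- The axis-parallel hyperplane `{x : x_j = c}`. -/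
def axisHyp (d : ℕ) (j : Fin d) (c : ℝ) : Set (Euc d) := {x : Euc d | x j = c}

/-- A weakly non-separable family of translates of the unit cube. -/
def CubeWNS {d n : ℕ} (p : Fin n → Euc d) : Prop :=
  ∀ (j : Fin d) (c : ℝ),
    (axisHyp d j c ∩ convexHull ℝ (⋃ k, {p k} + unitCube d)).Nonempty →
    ∃ k, (axisHyp d j c ∩ ({p k} + unitCube d)).Nonempty


/-- The intervals `[a i - s i, a i + s i]` cover every point lying between two of them. -/
def IntervalsCoverGaps {n : ℕ} (a s : Fin n → ℝ) : Prop :=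
  ∀ c : ℝ, (∃ i, a i - s i ≤ c) → (∃ i, c ≤ a i + s i) →
    ∃ k, a k - s k ≤ c ∧ c ≤ a k + s k

/-- The indices of the intervals whose right end lies strictly beyond that of the `i`-th one. -/
def beyond {n : ℕ} (a s : Fin n → ℝ) (i : Fin n) : Finset (Fin n) :=
  Finset.univ.filter fun k => a i + s i < a k + s k

lemma mem_beyond {n : ℕ} {a s : Fin n → ℝ} {i k : Fin n} :
    k ∈ beyond a s i ↔ a i + s i < a k + s k := by
  simp [beyond]

lemma IntervalsCoverGaps.sub_le {n : ℕ} {a s : Fin n → ℝ} (h : IntervalsCoverGaps a s)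
    (hs : ∀ i, 0 ≤ s i) (i j : Fin n) :
    (a j + s j) - (a i + s i) ≤ 2 * ∑ k ∈ beyond a s i, s k := by
  have hsub : Ioc (a i + s i) (a j + s j) ⊆
      ⋃ k ∈ beyond a s i, Icc (a k - s k) (a k + s k) := by
    rintro c ⟨hc1, hc2⟩
    obtain ⟨k, hk1, hk2⟩ := h c ⟨i, by linarith [hs i]⟩ ⟨j, hc2⟩
    simp only [mem_iUnion]
    exact ⟨k, mem_beyond.2 (by linarith), hk1, hk2⟩
  have hvol := (measure_mono hsub).trans
    (measure_biUnion_finset_le (μ := volume) (beyond a s i) _)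
  simp only [Real.volume_Ioc, Real.volume_Icc] at hvol
  rw [← ENNReal.ofReal_sum_of_nonneg (fun k _ => by linarith [hs k]),
    ENNReal.ofReal_le_ofReal_iff (Finset.sum_nonneg fun k _ => by linarith [hs k])] at hvol
  rw [Finset.mul_sum]
  refine hvol.trans (le_of_eq (Finset.sum_congr rfl fun k _ => by ring))

/-- Twice the sum of the products over strictly ordered pairs, plus the squares, plus the products
over tied pairs, is the square of the total. -/
lemma sum_mul_add_beyond {n : ℕ} (a s : Fin n → ℝ) :
    (∑ i, s i * (s i + 2 * ∑ k ∈ beyond a s i, s k)) +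
      ∑ i, ∑ k, (if i ≠ k ∧ a i + s i = a k + s k then s i * s k else 0) = (∑ i, s i) ^ 2 := by
  have hsq : ∑ i, s i * s i = ∑ i, ∑ k, (if i = k then s i * s k else 0) := by simp
  have hB : ∑ i, s i * ∑ k ∈ beyond a s i, s k =
      ∑ i, ∑ k, (if a i + s i < a k + s k then s i * s k else 0) := by
    refine Finset.sum_congr rfl fun i _ => ?_
    rw [beyond, Finset.sum_filter, Finset.mul_sum]
    exact Finset.sum_congr rfl fun k _ => by split_ifs <;> simp
  have hB' : ∑ i, s i * ∑ k ∈ beyond a s i, s k =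
      ∑ i, ∑ k, (if a k + s k < a i + s i then s i * s k else 0) := by
    rw [hB, Finset.sum_comm]
    simp only [mul_comm]
  have hsplit : ∑ i, s i * (s i + 2 * ∑ k ∈ beyond a s i, s k) =
      ∑ i, s i * s i + ∑ i, s i * ∑ k ∈ beyond a s i, s k +
        ∑ i, s i * ∑ k ∈ beyond a s i, s k := by
    rw [← Finset.sum_add_distrib, ← Finset.sum_add_distrib]
    exact Finset.sum_congr rfl fun i _ => by ring
  rw [hsplit]
  nth_rewrite 2 [hB']
  rw [hB, hsq, sq, Finset.sum_mul_sum]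
  simp only [← Finset.sum_add_distrib]
  refine Finset.sum_congr rfl fun i _ => Finset.sum_congr rfl fun k _ => ?_
  by_cases hik : i = k
  · subst hik; simp
  · rcases lt_trichotomy (a i + s i) (a k + s k) with hlt | heq | hgt
    · simp [hik, hlt, hlt.ne, hlt.not_gt]
    · simp [hik, heq]
    · simp [hik, hgt, hgt.ne', hgt.not_gt]

/-- If the farthest right end of a gap-covering family of intervals is almost as far as possible
from the weighted mean of the centres, then the right ends are well separated, and the intervals
are almost packed one after the other. -/
lemma IntervalsCoverGaps.almost_packed {n : ℕ} {a s : Fin n → ℝ} (h : IntervalsCoverGaps a s)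
    {t ε : ℝ} (ht : 0 < t) (hs : ∀ i, t ≤ s i) (hsmall : 2 * (∑ i, s i) * ε < t ^ 2)
    (j : Fin n) (hj : (∑ i, s i) * ((∑ i, s i) - 2 * ε) ≤ ∑ i, s i * ((a j + s j) - a i)) :
    ∃ m, (∀ i, a i + s i ≤ a m + s m) ∧
      (∀ i, s i + 2 * ∑ k ∈ beyond a s i, s k - 2 * (∑ i, s i) * ε / t ≤ (a m + s m) - a i) ∧
      ∀ i k, i ≠ k → a k + s k ≤ a i + s i → a k + s k + t ≤ a i + s i := by
  have hs0 : ∀ i, 0 < s i := fun i => ht.trans_le (hs i)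
  have : Nonempty (Fin n) := ⟨j⟩
  obtain ⟨m, hm⟩ := Finite.exists_max fun i => a i + s i
  set S := ∑ i, s i with hS
  set δ : Fin n → ℝ := fun i => s i + 2 * ∑ k ∈ beyond a s i, s k - ((a m + s m) - a i) with hδ
  set q : Fin n → Fin n → ℝ := fun i k =>
    if i ≠ k ∧ a i + s i = a k + s k then s i * s k else 0 with hq
  have hδ0 : ∀ i, 0 ≤ δ i := fun i => by
    have := h.sub_le (fun i => (hs0 i).le) i m
    simp only [hδ]; linarith
  have hq0 : ∀ i k, 0 ≤ q i k := fun i k => by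
    simp only [hq]; split_ifs
    · exact (mul_pos (hs0 i) (hs0 k)).le
    · exact le_rfl
  have hjm : ∑ i, s i * ((a j + s j) - a i) ≤ ∑ i, s i * ((a m + s m) - a i) :=
    Finset.sum_le_sum fun i _ => mul_le_mul_of_nonneg_left (by linarith [hm j]) (hs0 i).le
  have hid := sum_mul_add_beyond a s
  have hδsum : ∑ i, s i * δ i = ∑ i, s i * (s i + 2 * ∑ k ∈ beyond a s i, s k) -
      ∑ i, s i * ((a m + s m) - a i) := by
    rw [← Finset.sum_sub_distrib]
    exact Finset.sum_congr rfl fun i _ => by simp only [hδ]; ring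
  have htotal : ∑ i, s i * δ i + ∑ i, ∑ k, q i k ≤ 2 * S * ε := by
    rw [hδsum]
    have : S * (S - 2 * ε) = S ^ 2 - 2 * S * ε := by ring
    linarith
  have hδs0 : ∀ i ∈ Finset.univ, 0 ≤ s i * δ i := fun i _ => mul_nonneg (hs0 i).le (hδ0 i)
  have hqs0 : ∀ i ∈ Finset.univ, 0 ≤ ∑ k, q i k := fun i _ => Finset.sum_nonneg fun k _ => hq0 i k
  have hδle : ∀ i, δ i ≤ 2 * S * ε / t := fun i => by
    rw [le_div_iff₀ ht]
    have h1 := Finset.single_le_sum hδs0 (Finset.mem_univ i)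
    have h2 := Finset.sum_nonneg hqs0
    have h3 := mul_le_mul_of_nonneg_right (hs i) (hδ0 i)
    linarith
  have hlt : 2 * S * ε / t < t := by rw [div_lt_iff₀ ht]; linarith
  refine ⟨m, hm, fun i => by have := hδle i; simp only [hδ] at this; linarith, ?_⟩
  intro i k hik hle
  rcases hle.lt_or_eq with hki | hki
  · have h1 := (hδle k).trans hlt.le
    have h2 := h.sub_le (fun i => (hs0 i).le) i m
    have h3 : s i + ∑ l ∈ beyond a s i, s l ≤ ∑ l ∈ beyond a s k, s l := by
      have hni : i ∉ beyond a s i := by simp [mem_beyond]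
      rw [← Finset.sum_insert hni]
      refine Finset.sum_le_sum_of_subset_of_nonneg ?_ fun l _ _ => (hs0 l).le
      intro l hl
      rcases Finset.mem_insert.1 hl with rfl | hl
      · exact mem_beyond.2 hki
      · exact mem_beyond.2 (hki.trans (mem_beyond.1 hl))
    simp only [hδ] at h1
    linarith [hs i]
  · exfalso
    have h1 : q i k = s i * s k := if_pos ⟨hik, hki.symm⟩
    have h2 := Finset.single_le_sum (fun l _ => hq0 i l) (Finset.mem_univ k)
    have h3 := Finset.single_le_sum hqs0 (Finset.mem_univ i)
    have h4 := Finset.sum_nonneg hδs0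
    have h5 : t * t ≤ s i * s k := mul_le_mul (hs i) (hs k) ht.le (hs0 i).le
    linarith [sq t]

lemma mem_homo {x y : Euc d} {τ : ℝ} {K : Set (Euc d)} :
    y ∈ homo x τ K ↔ ∃ k ∈ K, x + τ • k = y := by
  simp only [homo, Set.singleton_add, Set.mem_smul_set, Set.mem_image, exists_exists_and_eq_and]

/-- In every direction, the projections of a non-separable family cover all gaps. -/
lemma NS.intervalsCoverGaps {n : ℕ} {K : Set (Euc d)} (hsymm : K = -K) {p : Fin n → Euc d}
    {τ : Fin n → ℝ} (hτ : ∀ i, 0 < τ i) (hNS : NS fun i => homo (p i) (τ i) K)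
    {u x : Euc d} (hu : u ≠ 0) (hxK : x ∈ K)
    (hx : ∀ y ∈ K, (inner ℝ y u : ℝ) ≤ inner ℝ x u) :
    IntervalsCoverGaps (fun i => (inner ℝ (p i) u : ℝ)) fun i => (inner ℝ x u : ℝ) * τ i := by
  have hneg : ∀ y ∈ K, -y ∈ K := fun y hy => by rw [hsymm]; simpa using hy
  rintro c ⟨i, hi⟩ ⟨j, hj⟩
  set U := convexHull ℝ (⋃ i, homo (p i) (τ i) K) with hU
  have hmem : ∀ i, ∀ y ∈ K, p i + τ i • y ∈ U := fun i y hy =>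
    subset_convexHull ℝ _ (mem_iUnion.2 ⟨i, mem_homo.2 ⟨y, hy, rfl⟩⟩)
  have hpre : IsPreconnected U := (convex_convexHull ℝ _).isPreconnected
  have hcont : ContinuousOn (fun y : Euc d => (inner ℝ y u : ℝ)) U := by fun_prop
  have hc : c ∈ (fun y : Euc d => (inner ℝ y u : ℝ)) '' U := by
    refine hpre.intermediate_value (hmem i (-x) (hneg x hxK)) (hmem j x hxK) hcont ⟨?_, ?_⟩
    · simp only [inner_add_left, inner_smul_left, inner_neg_left]; simp; linarith
    · simp only [inner_add_left, inner_smul_left]; simp; linarith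
  obtain ⟨y, hyU, hyc⟩ := hc
  obtain ⟨k, z, hz, hzk⟩ := hNS {y | (inner ℝ y u : ℝ) = c} ⟨u, hu, c, rfl⟩ ⟨y, hyc, hyU⟩
  obtain ⟨w, hw, rfl⟩ := mem_homo.1 hzk
  have hz' : (inner ℝ (p k) u : ℝ) + τ k * inner ℝ w u = c := by
    have : (inner ℝ (p k + τ k • w) u : ℝ) = c := hz
    simpa [inner_add_left, inner_smul_left] using this
  have h1 := hx w hw
  have h2 := hx (-w) (hneg w hw)
  rw [inner_neg_left] at h2
  refine ⟨k, ?_, ?_⟩ <;> dsimp only <;> nlinarith [hτ k]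

/-- A convex body sliding freely in a ball of radius `r` contains a ball of radius
`‖x - y‖ ^ 2 / (8 * r)` around the midpoint of any two of its points `x`, `y`. -/
lemma ball_midpoint_subset {K : Set (Euc d)} (hK : IsConvexBody K) {r : ℝ} (hr : 0 < r)
    (hslide : ∀ x ∈ frontier K, ∃ c : Euc d, ‖x - c‖ = r ∧ K ⊆ Metric.closedBall c r)
    {x y : Euc d} (hx : x ∈ K) (hy : y ∈ K) :
    Metric.ball ((1 / 2 : ℝ) • (x + y)) (‖x - y‖ ^ 2 / (8 * r)) ⊆ K := by
  set m := (1 / 2 : ℝ) • (x + y) with hm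
  have hmK : m ∈ K := by
    have := hK.2.1 hx hy (by norm_num : (0 : ℝ) ≤ 1 / 2) (by norm_num : (0 : ℝ) ≤ 1 / 2)
      (by norm_num)
    rwa [hm, smul_add]
  have hfront : ∀ z ∈ frontier K, ‖x - y‖ ^ 2 / (8 * r) ≤ ‖z - m‖ := by
    intro z hz
    obtain ⟨c, hzc, hKc⟩ := hslide z hz
    have hxc : ‖x - c‖ ≤ r := by simpa [dist_eq_norm] using hKc hx
    have hyc : ‖y - c‖ ≤ r := by simpa [dist_eq_norm] using hKc hy
    have hpar := parallelogram_law_with_norm ℝ (x - c) (y - c)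
    have e1 : (x - c) + (y - c) = (2 : ℝ) • (m - c) := by rw [hm]; module
    have e2 : (x - c) - (y - c) = x - y := by abel
    rw [e1, e2, norm_smul, Real.norm_eq_abs, abs_of_pos (by norm_num : (0 : ℝ) < 2)] at hpar
    have htri : r ≤ ‖z - m‖ + ‖m - c‖ := by
      rw [← hzc]; exact norm_sub_le_norm_sub_add_norm_sub z m c
    rw [div_le_iff₀ (by positivity)]
    have hx2 : ‖x - c‖ * ‖x - c‖ ≤ r * r := mul_self_le_mul_self (norm_nonneg _) hxc
    have hy2 : ‖y - c‖ * ‖y - c‖ ≤ r * r := mul_self_le_mul_self (norm_nonneg _) hyc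
    have hkey : ‖x - y‖ ^ 2 ≤ 4 * (r ^ 2 - ‖m - c‖ ^ 2) := by nlinarith
    have hsq : r ^ 2 - ‖m - c‖ ^ 2 ≤ 2 * r * (r - ‖m - c‖) := by
      nlinarith [sq_nonneg (r - ‖m - c‖)]
    nlinarith
  intro z hz
  by_contra hzK
  have hsub : Metric.ball m (‖x - y‖ ^ 2 / (8 * r)) ⊆ interior K ∪ Kᶜ := fun w hw => by
    by_cases hwK : w ∈ K
    · refine Or.inl (by_contra fun hwi => ?_)
      rw [Metric.mem_ball, dist_eq_norm] at hw
      exact (hfront w ⟨subset_closure hwK, hwi⟩).not_gt hw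
    · exact Or.inr hwK
  have hmb : m ∈ Metric.ball m (‖x - y‖ ^ 2 / (8 * r)) :=
    Metric.mem_ball_self (Metric.pos_of_mem_ball hz)
  have hmi : m ∈ interior K := (hsub hmb).resolve_right fun h => h hmK
  exact hzK (interior_subset ((convex_ball m _).isPreconnected.subset_left_of_subset_union
    isOpen_interior hK.1.isClosed.isOpen_compl
    (disjoint_compl_right.mono_left interior_subset) hsub ⟨m, hmb, hmi⟩ hz))

lemma norm_sq_le_inner_of_support {K : Set (Euc d)} (hK : IsConvexBody K) {r : ℝ} (hr : 0 < r)
    (hslide : ∀ x ∈ frontier K, ∃ c : Euc d, ‖x - c‖ = r ∧ K ⊆ Metric.closedBall c r)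
    {u x y : Euc d} (hu : ‖u‖ = 1) (hxK : x ∈ K)
    (hx : ∀ y ∈ K, (inner ℝ y u : ℝ) ≤ inner ℝ x u) (hy : y ∈ K) :
    ‖x - y‖ ^ 2 / (4 * r) ≤ inner ℝ (x - y) u := by
  have hball := ball_midpoint_subset hK hr hslide hxK hy
  set ρ := ‖x - y‖ ^ 2 / (8 * r) with hρ
  have h4 : ‖x - y‖ ^ 2 / (4 * r) = 2 * ρ := by rw [hρ]; field_simp; ring
  rw [h4, inner_sub_left]
  suffices h : ρ ≤ ((inner ℝ x u : ℝ) - inner ℝ y u) / 2 by linarith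
  refine le_of_forall_lt_imp_le_of_dense fun σ hσ => ?_
  rcases le_or_gt 0 σ with h0 | h0
  · have := hx _ (hball (show (1 / 2 : ℝ) • (x + y) + σ • u ∈ _ by
      rw [Metric.mem_ball, dist_eq_norm, add_sub_cancel_left, norm_smul, hu, mul_one,
        Real.norm_of_nonneg h0]
      exact hσ))
    simp only [inner_add_left, inner_smul_left, real_inner_self_eq_norm_sq, hu] at this
    simp at this
    linarith
  · linarith [hx y hy]

/-- The support function of a convex body sliding freely in a ball grows at most quadratically
beyond its linearization. -/
lemma inner_add_smul_le {K : Set (Euc d)} (hK : IsConvexBody K) {r : ℝ} (hr : 0 < r)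
    (hslide : ∀ x ∈ frontier K, ∃ c : Euc d, ‖x - c‖ = r ∧ K ⊆ Metric.closedBall c r)
    {u x y w : Euc d} (hu : ‖u‖ = 1) (hw : ‖w‖ = 1) (hxK : x ∈ K)
    (hx : ∀ y ∈ K, (inner ℝ y u : ℝ) ≤ inner ℝ x u) (hy : y ∈ K) {η : ℝ} (hη : 0 ≤ η) :
    (inner ℝ y (u + η • w) : ℝ) ≤ inner ℝ x (u + η • w) + r * η ^ 2 := by
  have h1 := norm_sq_le_inner_of_support hK hr hslide hu hxK hx hy
  have h2 : (inner ℝ (y - x) w : ℝ) ≤ ‖x - y‖ := by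
    have := real_inner_le_norm (y - x) w
    rwa [hw, mul_one, norm_sub_rev] at this
  rw [div_le_iff₀ (by positivity)] at h1
  have h3 : (inner ℝ y (u + η • w) : ℝ) - inner ℝ x (u + η • w) =
      -(inner ℝ (x - y) u : ℝ) + η * inner ℝ (y - x) w := by
    simp only [inner_add_right, inner_smul_right, inner_sub_left]; ring
  have h4 : η * (inner ℝ (y - x) w : ℝ) ≤ η * ‖x - y‖ := mul_le_mul_of_nonneg_left h2 hη
  have h5 : η * ‖x - y‖ ≤ (inner ℝ (x - y) u : ℝ) + r * η ^ 2 := by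
    have : (4 * r) * (η * ‖x - y‖) ≤ (4 * r) * ((inner ℝ (x - y) u : ℝ) + r * η ^ 2) := by
      nlinarith [sq_nonneg (‖x - y‖ - 2 * r * η)]
    exact le_of_mul_le_mul_left this (by positivity)
  linarith

/-- An o-symmetric convex body contains a ball around the origin. -/
lemma exists_closedBall_subset {K : Set (Euc d)} (hK : IsConvexBody K) (hsymm : K = -K) :
    ∃ ρ > 0, Metric.closedBall (0 : Euc d) ρ ⊆ K := by
  obtain ⟨z, hz⟩ := hK.2.2
  obtain ⟨ρ, hρ, hball⟩ := Metric.nhds_basis_closedBall.mem_iff.1 (mem_interior_iff_mem_nhds.1 hz)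
  refine ⟨ρ, hρ, fun y hy => ?_⟩
  have hy' : ‖y‖ ≤ ρ := by simpa using hy
  have h1 : z + y ∈ K := hball (by simpa using hy')
  have h2 : -(z - y) ∈ K := by
    rw [hsymm]; simpa using hball (show z - y ∈ Metric.closedBall z ρ by simpa using hy')
  have := hK.2.1 h1 h2 (by norm_num : (0 : ℝ) ≤ 1 / 2) (by norm_num : (0 : ℝ) ≤ 1 / 2)
    (by norm_num)
  convert this using 1
  module

lemma exists_support_point {K : Set (Euc d)} (hK : IsConvexBody K) (u : Euc d) :
    ∃ x ∈ K, ∀ y ∈ K, (inner ℝ y u : ℝ) ≤ inner ℝ x u := by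
  obtain ⟨x, hx, hmax⟩ := hK.1.exists_isMaxOn (hK.2.2.mono interior_subset)
    (f := fun y : Euc d => (inner ℝ y u : ℝ)) (by fun_prop)
  exact ⟨x, hx, fun y hy => hmax hy⟩

lemma exists_unit_direction_of_notMem_homo {K : Set (Euc d)} (hK : IsConvexBody K)
    {x z : Euc d} {lam : ℝ} (hz : z ∉ homo x lam K) :
    ∃ u : Euc d, ‖u‖ = 1 ∧
      ∀ k ∈ K, (inner ℝ x u : ℝ) + lam * inner ℝ k u < inner ℝ z u := by
  obtain ⟨f, c, hf, hfz⟩ := geometric_hahn_banach_closed_point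
    ((convex_singleton x).add (hK.2.1.smul lam))
    (isCompact_singleton.add (hK.1.smul lam)).isClosed hz
  obtain ⟨u, rfl⟩ := (InnerProductSpace.toDual ℝ (Euc d)).surjective f
  simp only [InnerProductSpace.toDual_apply_apply] at hf hfz
  have hlt : ∀ k ∈ K, (inner ℝ x u : ℝ) + lam * inner ℝ k u < inner ℝ z u := fun k hk => by
    have := (hf _ (mem_homo.2 ⟨k, hk, rfl⟩)).trans hfz
    rw [real_inner_comm, real_inner_comm z u] at this
    simpa only [inner_add_left, real_inner_smul_left] using this
  obtain ⟨k₀, hk₀⟩ := hK.2.2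
  have hu : u ≠ 0 := by
    rintro rfl
    simpa using hlt k₀ (interior_subset hk₀)
  have hu' : 0 < ‖u‖⁻¹ := inv_pos.2 (norm_pos_iff.2 hu)
  refine ⟨‖u‖⁻¹ • u, by rw [norm_smul, norm_inv, norm_norm, inv_mul_cancel₀ (norm_ne_zero_iff.2 hu)],
    fun k hk => ?_⟩
  simp only [real_inner_smul_right]
  nlinarith [mul_lt_mul_of_pos_left (hlt k hk) hu']

/-- The centres of a non-separable family of homothets lie within a bounded distance. -/
lemma NS.norm_sub_le {n : ℕ} {K : Set (Euc d)} (hK : IsConvexBody K) (hsymm : K = -K)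
    (h0K : (0 : Euc d) ∈ K) {R : ℝ} (hR : ∀ y ∈ K, ‖y‖ ≤ R) {p : Fin n → Euc d}
    {τ : Fin n → ℝ} (hτ : ∀ i, 0 < τ i) (hNS : NS fun i => homo (p i) (τ i) K) (i k : Fin n) :
    ‖p k - p i‖ ≤ 3 * (∑ l, τ l) * R := by
  have hR0 : 0 ≤ R := (norm_nonneg _).trans (hR 0 h0K)
  have hT : 0 ≤ ∑ l, τ l := Finset.sum_nonneg fun l _ => (hτ l).le
  by_cases hv : p k - p i = 0
  · rw [hv, norm_zero]; positivity
  obtain ⟨v, hvdef⟩ : ∃ v, v = p k - p i := ⟨_, rfl⟩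
  rw [← hvdef] at hv ⊢
  obtain ⟨x, hxK, hx⟩ := exists_support_point hK v
  have hcover := hNS.intervalsCoverGaps hsymm hτ hv hxK hx
  set h : ℝ := inner ℝ x v with hh
  have hh0 : 0 ≤ h := by simpa using hx 0 h0K
  have hhR : h ≤ R * ‖v‖ :=
    (real_inner_le_norm _ _).trans (mul_le_mul_of_nonneg_right (hR x hxK) (norm_nonneg _))
  have h1 := hcover.sub_le (fun l => mul_nonneg hh0 (hτ l).le) i k
  have h2 : ∑ l ∈ beyond (fun i => (inner ℝ (p i) v : ℝ)) (fun i => h * τ i) i, h * τ l ≤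
      h * ∑ l, τ l := by
    rw [Finset.mul_sum]
    exact Finset.sum_le_sum_of_subset_of_nonneg (Finset.subset_univ _)
      fun l _ _ => mul_nonneg hh0 (hτ l).le
  have h3 : τ i ≤ ∑ l, τ l :=
    Finset.single_le_sum (fun l _ => (hτ l).le) (Finset.mem_univ i)
  have h4 : (inner ℝ (p k) v : ℝ) - inner ℝ (p i) v = ‖v‖ * ‖v‖ := by
    rw [← inner_sub_left, ← hvdef, real_inner_self_eq_norm_mul_norm]
  have h5 : ‖v‖ * ‖v‖ ≤ 3 * (∑ l, τ l) * R * ‖v‖ := by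
    have e1 : h * τ i ≤ h * ∑ l, τ l := mul_le_mul_of_nonneg_left h3 hh0
    have e2 : 0 ≤ h * τ k := mul_nonneg hh0 (hτ k).le
    have e3 : h * ∑ l, τ l ≤ R * ‖v‖ * ∑ l, τ l := mul_le_mul_of_nonneg_right hhR hT
    linarith
  exact le_of_mul_le_mul_right h5 (norm_pos_iff.2 hv)

/-- If the right ends of the projections in direction `u` are well separated, then a slight
rotation of the direction does not change their order, and the extent of the family in the rotated
direction is still bounded by the packing with the order of `u`. -/
lemma NS.inner_sub_le_of_separated {n : ℕ} {K : Set (Euc d)} (hK : IsConvexBody K)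
    (hsymm : K = -K) (h0K : (0 : Euc d) ∈ K) {R : ℝ} (hR : ∀ y ∈ K, ‖y‖ ≤ R)
    {p : Fin n → Euc d} {τ : Fin n → ℝ} (hτ : ∀ i, 0 < τ i)
    (hNS : NS fun i => homo (p i) (τ i) K) {u w x x' : Euc d} {η σ : ℝ} (hη : 0 ≤ η)
    (hw : ‖w‖ = 1) (hne : u + η • w ≠ 0) (hxK : x ∈ K)
    (hx : ∀ y ∈ K, (inner ℝ y u : ℝ) ≤ inner ℝ x u) (hx'K : x' ∈ K)
    (hx' : ∀ y ∈ K, (inner ℝ y (u + η • w) : ℝ) ≤ inner ℝ x' (u + η • w))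
    (hsep : ∀ i k, i ≠ k →
      (inner ℝ (p k) u : ℝ) + inner ℝ x u * τ k ≤ (inner ℝ (p i) u : ℝ) + inner ℝ x u * τ i →
      (inner ℝ (p k) u : ℝ) + inner ℝ x u * τ k + σ ≤ (inner ℝ (p i) u : ℝ) + inner ℝ x u * τ i)
    (hσ : η * (4 * (∑ l, τ l) * R) ≤ σ) (i m : Fin n) :
    (inner ℝ (p m - p i) (u + η • w) : ℝ) ≤ inner ℝ x' (u + η • w) *
      (2 * ∑ k ∈ beyond (fun i => (inner ℝ (p i) u : ℝ)) (fun i => (inner ℝ x u : ℝ) * τ i) i, τ k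
        + τ i - τ m) := by
  have hcover := hNS.intervalsCoverGaps hsymm hτ hne hx'K hx'
  have hR0 : 0 ≤ R := (norm_nonneg _).trans (hR 0 h0K)
  have hh'0 : 0 ≤ (inner ℝ x' (u + η • w) : ℝ) := by simpa using hx' 0 h0K
  have hbound : ∀ y ∈ K, |(inner ℝ y w : ℝ)| ≤ R := fun y hy => by
    have := abs_real_inner_le_norm y w
    rw [hw, mul_one] at this
    exact this.trans (hR y hy)
  have hexp : ∀ y : Euc d, (inner ℝ y (u + η • w) : ℝ) = inner ℝ y u + η * inner ℝ y w :=
    fun y => by rw [inner_add_right, real_inner_smul_right]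
  have hdiff : |(inner ℝ x' (u + η • w) : ℝ) - inner ℝ x u| ≤ η * R := by
    have e1 := hx x' hx'K
    have e2 := hx' x hxK
    rw [hexp, hexp] at e2
    rw [hexp, abs_le]
    have e3 := mul_le_mul_of_nonneg_left (abs_le.1 (hbound x' hx'K)).2 hη
    have e4 := mul_le_mul_of_nonneg_left (abs_le.1 (hbound x hxK)).1 hη
    constructor <;> linarith
  set h' : ℝ := inner ℝ x' (u + η • w) with hh'
  set h : ℝ := inner ℝ x u with hh
  have hsubset : beyond (fun i => (inner ℝ (p i) (u + η • w) : ℝ)) (fun i => h' * τ i) i ⊆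
      beyond (fun i => (inner ℝ (p i) u : ℝ)) (fun i => h * τ i) i := by
    intro k hk
    rw [mem_beyond] at hk ⊢
    by_contra hki
    have hik : i ≠ k := by rintro rfl; exact lt_irrefl _ hk
    have e1 := hsep i k hik (not_lt.1 hki)
    have e2 : η * (inner ℝ (p k - p i) w : ℝ) ≤ η * (3 * (∑ l, τ l) * R) := by
      refine mul_le_mul_of_nonneg_left ?_ hη
      have := real_inner_le_norm (p k - p i) w
      rw [hw, mul_one] at this
      exact this.trans (hNS.norm_sub_le hK hsymm h0K hR hτ i k)
    have e3 : |τ k - τ i| ≤ ∑ l, τ l := by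
      have hi := Finset.single_le_sum (fun l _ => (hτ l).le) (Finset.mem_univ i)
      have hk := Finset.single_le_sum (fun l _ => (hτ l).le) (Finset.mem_univ k)
      rw [abs_le]; constructor <;> linarith [hτ i, hτ k]
    have e4 : (h' - h) * (τ k - τ i) ≤ η * R * ∑ l, τ l :=
      (le_abs_self _).trans <| by
        rw [abs_mul]; exact mul_le_mul hdiff e3 (abs_nonneg _) (mul_nonneg hη hR0)
    rw [inner_sub_left] at e2
    simp only [hexp] at hk
    linarith
  have h1 := hcover.sub_le (fun l => mul_nonneg hh'0 (hτ l).le) i m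
  have h2 := Finset.sum_le_sum_of_subset_of_nonneg (f := fun k => h' * τ k) hsubset
    fun l _ _ => mul_nonneg hh'0 (hτ l).le
  rw [← Finset.mul_sum, ← Finset.mul_sum] at h2
  rw [← Finset.mul_sum] at h1
  rw [inner_sub_left]
  linarith

/-- stability of the covering theorem for NS-families of
smooth o-symmetric convex bodies. -/
theorem stmt_0 (d n : ℕ) (hd : 2 ≤ d) (hn : 2 ≤ n)
    (K : Set (Euc d)) (hK : IsConvexBody K) (hsymm : K = -K)
    (r : ℝ) (hr : 0 < r)
    (hslide : ∀ x ∈ frontier K, ∃ c : Euc d, ‖x - c‖ = r ∧ K ⊆ Metric.closedBall c r)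
    (τ : Fin n → ℝ) (hτ : ∀ i, 0 < τ i) :
    ∃ C > (0 : ℝ), ∃ D > (0 : ℝ), ∀ p : Fin n → Euc d,
      NS (fun i => homo (p i) (τ i) K) →
      ∀ ε : ℝ, 0 < ε → ε ≤ D →
      (∀ (x : Euc d) (lam : ℝ), 0 < lam → (⋃ i, homo (p i) (τ i) K) ⊆ homo x lam K →
        (∑ i, τ i) - ε ≤ lam) →
      ∃ L : Set (Euc d), IsLine L ∧ ∀ i, Metric.infDist (p i) L ≤ C * Real.sqrt ε := by
  obtain ⟨ρ, hρ, hball⟩ := exists_closedBall_subset hK hsymm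
  have h0K : (0 : Euc d) ∈ K := hball (by simpa using hρ.le)
  obtain ⟨R, hRpos, hR⟩ := hK.1.isBounded.exists_pos_norm_le
  have : Nonempty (Fin n) := ⟨⟨0, by omega⟩⟩
  obtain ⟨i₀, hi₀⟩ := Finite.exists_min τ
  set t := τ i₀ with ht
  have ht0 : 0 < t := hτ i₀
  set T := ∑ i, τ i with hT
  have hT0 : 0 < T := Finset.sum_pos (fun i _ => hτ i) Finset.univ_nonempty
  refine ⟨3 * T * r + 2 * R * T / t, by positivity,
    min (min (1 / 4) (T / 4)) (min (t ^ 2 / (4 * T)) ((ρ * t / (4 * T * R)) ^ 2)),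
    by positivity, ?_⟩
  intro p hNS ε hε hεD hcirc
  simp only [le_min_iff] at hεD
  obtain ⟨⟨hε1, hε2⟩, hε3, hε4⟩ := hεD
  rw [le_div_iff₀ (by positivity)] at hε3
  set η := Real.sqrt ε with hη
  have hη0 : 0 < η := Real.sqrt_pos.2 hε
  have hηsq : η ^ 2 = ε := Real.sq_sqrt hε.le
  have hη1 : η < 1 := by nlinarith
  have hη2 : η * (4 * T * R) ≤ ρ * t := by
    rw [← le_div_iff₀ (by positivity)]
    exact Real.sqrt_le_iff.2 ⟨by positivity, hε4⟩
  obtain ⟨y, hyU, hyc⟩ : ∃ y ∈ ⋃ i, homo (p i) (τ i) K,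
      y ∉ homo (T⁻¹ • ∑ i, τ i • p i) (T - 2 * ε) K := by
    by_contra! hcon
    have := hcirc _ (T - 2 * ε) (by linarith) hcon
    linarith
  obtain ⟨j, hyj⟩ := mem_iUnion.1 hyU
  obtain ⟨k, hkK, rfl⟩ := mem_homo.1 hyj
  obtain ⟨u, hu, hsepu⟩ := exists_unit_direction_of_notMem_homo hK hyc
  obtain ⟨x, hxK, hx⟩ := exists_support_point hK u
  have hu0 : u ≠ 0 := norm_ne_zero_iff.1 (by rw [hu]; exact one_ne_zero)
  have hcover := hNS.intervalsCoverGaps hsymm hτ hu0 hxK hx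
  have hfar := hsepu x hxK
  have hkx := hx k hkK
  have hhR : (inner ℝ x u : ℝ) ≤ R := by
    have := real_inner_le_norm x u
    rw [hu, mul_one] at this
    exact this.trans (hR x hxK)
  have hhρ : ρ ≤ (inner ℝ x u : ℝ) := by
    have := hx (ρ • u) (hball (by simp [norm_smul, hu, abs_of_pos hρ]))
    rwa [real_inner_smul_left, real_inner_self_eq_norm_sq, hu, one_pow, mul_one] at this
  obtain ⟨h, hh⟩ : ∃ h : ℝ, h = inner ℝ x u := ⟨_, rfl⟩
  rw [← hh] at hcover hfar hkx hhR hhρ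
  have hh0 : 0 < h := hρ.trans_le hhρ
  have hS : ∑ i, h * τ i = h * T := by rw [hT, Finset.mul_sum]
  have hfar' : (T - 2 * ε) * h <
      (inner ℝ (p j) u : ℝ) + h * τ j - inner ℝ (T⁻¹ • ∑ i, τ i • p i) u := by
    rw [inner_add_left, real_inner_smul_left k u (τ j)] at hfar
    nlinarith [mul_le_mul_of_nonneg_left hkx (hτ j).le]
  have hmean : T * (inner ℝ (T⁻¹ • ∑ i, τ i • p i) u : ℝ) = ∑ i, τ i * inner ℝ (p i) u := by
    rw [real_inner_smul_left, mul_inv_cancel_left₀ hT0.ne', sum_inner]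
    simp only [real_inner_smul_left]
  obtain ⟨m, hm, hpack, hsep⟩ := hcover.almost_packed (t := h * t) (ε := h * ε)
    (by positivity) (fun i => mul_le_mul_of_nonneg_left (hi₀ i) hh0.le)
    (by
      rw [hS]
      have : 2 * (h * T) * (h * ε) = h ^ 2 * (2 * T * ε) := by ring
      rw [this, mul_pow]
      refine mul_lt_mul_of_pos_left ?_ (by positivity)
      nlinarith [mul_pos hT0 hε])
    j (by
      have hsum : ∑ i, h * τ i * ((inner ℝ (p j) u : ℝ) + h * τ j - inner ℝ (p i) u) =
          h * (T * ((inner ℝ (p j) u : ℝ) + h * τ j) - ∑ i, τ i * inner ℝ (p i) u) := by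
        rw [hT, Finset.sum_mul, ← Finset.sum_sub_distrib, Finset.mul_sum]
        exact Finset.sum_congr rfl fun i _ => by ring
      rw [hsum, hS, ← hmean]
      nlinarith [mul_lt_mul_of_pos_left hfar' (mul_pos hh0 hT0)])
  have hx0 : x ≠ 0 := by rintro rfl; simp at hh; linarith
  refine ⟨{z | ∃ s : ℝ, z = p m + s • x}, ⟨p m, x, hx0, rfl⟩, fun i => ?_⟩
  obtain ⟨B, hB⟩ : ∃ B, B = ∑ l ∈ beyond (fun i => (inner ℝ (p i) u : ℝ))
    (fun i => h * τ i) i, τ l := ⟨_, rfl⟩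
  have hBT : B ≤ T := hB ▸ Finset.sum_le_sum_of_subset_of_nonneg (Finset.subset_univ _)
    fun l _ _ => (hτ l).le
  have hτT : τ i ≤ T := Finset.single_le_sum (fun l _ => (hτ l).le) (Finset.mem_univ i)
  have hB0 : 0 ≤ B := hB ▸ Finset.sum_nonneg fun l _ => (hτ l).le
  have hF0 : 0 ≤ 2 * B + τ i - τ m := by
    by_cases him : i = m
    · subst him; linarith
    · have hmem : m ∈ beyond (fun i => (inner ℝ (p i) u : ℝ)) (fun i => h * τ i) i := by
        rw [mem_beyond]
        linarith [hsep m i (Ne.symm him) (hm i), mul_pos hh0 ht0]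
      have := Finset.single_le_sum (f := τ) (fun l _ => (hτ l).le) hmem
      rw [← hB] at this
      linarith [hτ i, hτ m]
  obtain ⟨F, hF⟩ : ∃ F, F = 2 * B + τ i - τ m := ⟨_, rfl⟩
  rw [← hF] at hF0
  have hFT : F ≤ 3 * T := by linarith [hτ m]
  have hlow : h * F - 2 * R * T / t * ε ≤ (inner ℝ (p m - p i) u : ℝ) := by
    have h1 := hpack i
    rw [← Finset.mul_sum, ← hB, hS] at h1
    have h2 : 2 * (h * T) * (h * ε) / (h * t) = h * (2 * T / t * ε) := by
      field_simp
    have h3 : h * (2 * T / t * ε) ≤ R * (2 * T / t * ε) :=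
      mul_le_mul_of_nonneg_right hhR (by positivity)
    have h4 : R * (2 * T / t * ε) = 2 * R * T / t * ε := by ring
    rw [inner_sub_left, hF]
    linarith
  have hup : ∀ w : Euc d, ‖w‖ = 1 →
      (inner ℝ (p m - p i) (u + η • w) : ℝ) ≤ F * (inner ℝ x (u + η • w) + r * η ^ 2) := by
    intro w hw
    obtain ⟨x', hx'K, hx'⟩ := exists_support_point hK (u + η • w)
    have hne : u + η • w ≠ 0 := fun hzero => by
      have : ‖u‖ = ‖η • w‖ := by rw [eq_neg_of_add_eq_zero_left hzero, norm_neg]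
      rw [hu, norm_smul, hw, mul_one, Real.norm_of_nonneg hη0.le] at this
      linarith
    have h1 := hNS.inner_sub_le_of_separated hK hsymm h0K hR hτ hη0.le hw hne hxK hx hx'K hx'
      (σ := h * t) (by rw [← hh]; exact hsep)
      (hη2.trans (mul_le_mul_of_nonneg_right hhρ ht0.le)) i m
    rw [← hh, ← hB, ← hF, mul_comm] at h1
    exact h1.trans (mul_le_mul_of_nonneg_left
      (inner_add_smul_le hK hr hslide hu hw hxK hx hx'K hη0.le) hF0)
  have hz : ‖p m - p i - F • x‖ ≤ (3 * T * r + 2 * R * T / t) * η := by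
    by_cases hz0 : p m - p i - F • x = 0
    · rw [hz0, norm_zero]; positivity
    have hpos := norm_pos_iff.2 hz0
    obtain ⟨z, hzdef⟩ : ∃ z, z = p m - p i - F • x := ⟨_, rfl⟩
    rw [← hzdef] at hpos ⊢
    have h1 := hup (‖z‖⁻¹ • z) (by
      rw [norm_smul, norm_inv, norm_norm, inv_mul_cancel₀ hpos.ne'])
    have hv : p m - p i = z + F • x := by rw [hzdef]; abel
    have hzz : (inner ℝ z (‖z‖⁻¹ • z) : ℝ) = ‖z‖ := by
      rw [real_inner_smul_right, real_inner_self_eq_norm_mul_norm, inv_mul_cancel_left₀ hpos.ne']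
    rw [hv, inner_add_left, real_inner_smul_left, ← hh] at hlow
    rw [hv, inner_add_left, real_inner_smul_left, inner_add_right z, real_inner_smul_right z,
      hzz] at h1
    have h2 : F * (r * η ^ 2) ≤ 3 * T * (r * η ^ 2) :=
      mul_le_mul_of_nonneg_right hFT (by positivity)
    have h3 : ‖z‖ * η ≤ (3 * T * r + 2 * R * T / t) * η * η := by
      rw [← hηsq] at hlow
      linarith
    exact le_of_mul_le_mul_right h3 hη0
  have hmemL : p m + (-F) • x ∈ {z | ∃ s : ℝ, z = p m + s • x} := ⟨-F, rfl⟩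
  refine (Metric.infDist_le_dist_of_mem hmemL).trans ?_
  have hdist : p m + (-F) • x - p i = p m - p i - F • x := by module
  rwa [dist_comm, dist_eq_norm, hdist]

end
end

section
/- Let K be an o-symmetric convex body in ℝ² and let L be a full-rank lattice in ℝ² such that the lattice arrangement L + K = ⋃_{z∈L}(z + K) is non-separable, i.e., every line in ℝ² intersects L + K. Then the tightness of this arrangement is at most one: for every x ∈ ℝ² and every λ > 1, the interior of x + λK intersects L + K. Moreover, if there exists x ∈ ℝ² such that the interior of x + K is disjoint from L + K, then K is a parallelogram. -/
open Set Metric Pointwise MeasureTheory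

noncomputable section

variable {d : ℕ}

/-- A parallelogram in the plane. -/
def IsParallelogram (K : Set (Euc 2)) : Prop :=
  ∃ c v w : Euc 2, LinearIndependent ℝ ![v, w] ∧
    K = (fun st : ℝ × ℝ => c + st.1 • v + st.2 • w) ''
      (Set.Icc (-1 : ℝ) 1 ×ˢ Set.Icc (-1 : ℝ) 1)

/-- A centrally symmetric convex planar region, given by its membership predicate in coordinates. -/
structure SymConv (M : ℝ → ℝ → Prop) : Prop where
  neg : ∀ {x y}, M x y → M (-x) (-y)
  comb : ∀ {x y x' y' s t}, M x y → M x' y' → 0 ≤ s → 0 ≤ t → s + t = 1 →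
    M (s * x + t * x') (s * y + t * y')

/-- No nonzero linear functional attains at `(x, y)` its supremum over the region `M`. -/
def StrictIn (M : ℝ → ℝ → Prop) (x y : ℝ) : Prop :=
  ∀ k l : ℝ, (k ≠ 0 ∨ l ≠ 0) → ∃ x' y', M x' y' ∧ k * x + l * y < k * x' + l * y'

/-- The integer translates of the region `M` cover the plane. -/
def IntCovers (M : ℝ → ℝ → Prop) : Prop :=
  ∀ p q : ℝ, ∃ i j : ℤ, M (p - i) (q - j)

/-- The region `M` is a parallelogram centred at the origin. -/
def IsPara (M : ℝ → ℝ → Prop) : Prop :=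
  ∃ v₁ v₂ w₁ w₂ : ℝ, v₁ * w₂ - v₂ * w₁ ≠ 0 ∧ ∀ x y, M x y ↔
    ∃ s ∈ Icc (-1 : ℝ) 1, ∃ t ∈ Icc (-1 : ℝ) 1, x = s * v₁ + t * w₁ ∧ y = s * v₂ + t * w₂

/-- The dichotomy: the interiors of the integer translates cover the plane, or the closed
translates do and the region is a parallelogram. -/
def CoverAlt (M : ℝ → ℝ → Prop) : Prop :=
  IntCovers (StrictIn M) ∨ IntCovers M ∧ IsPara M

namespace SymConv

variable {M : ℝ → ℝ → Prop}

theorem interp (h : SymConv M) {x₁ y₁ x₂ y₂ c : ℝ} (h₁ : M x₁ y₁) (h₂ : M x₂ y₂)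
    (hc₁ : x₁ ≤ c) (hc₂ : c ≤ x₂) (hlt : x₁ < x₂) :
    M c ((y₁ * (x₂ - c) + y₂ * (c - x₁)) / (x₂ - x₁)) := by
  have hd : 0 < x₂ - x₁ := sub_pos.2 hlt
  have := h.comb h₁ h₂ (div_nonneg (sub_nonneg.2 hc₂) hd.le)
    (div_nonneg (sub_nonneg.2 hc₁) hd.le) (by field_simp; ring)
  convert this using 1
  · field_simp
    ring
  · field_simp

theorem reflect (h : SymConv M) : SymConv fun x y => M x (-y) where
  neg hM := h.neg hM
  comb h₁ h₂ hs ht hst := by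
    convert h.comb h₁ h₂ hs ht hst using 1; ring

theorem swap (h : SymConv M) : SymConv fun x y => M y x where
  neg hM := h.neg hM
  comb h₁ h₂ hs ht hst := h.comb h₁ h₂ hs ht hst

/-- The points of the region over `x ∈ [-1/2, 1/2]` given by two points over `1/2`. -/
theorem chord (h : SymConv M) {y₁ y₂ x : ℝ} (h₁ : M (1 / 2) y₁) (h₂ : M (1 / 2) y₂)
    (hx : |x| ≤ 1 / 2) : M x ((1 / 2 + x) * y₁ - (1 / 2 - x) * y₂) := by
  obtain ⟨hx1, hx2⟩ := abs_le.1 hx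
  have := h.comb h₁ (h.neg h₂) (s := 1 / 2 + x) (t := 1 / 2 - x)
    (by linarith) (by linarith) (by ring)
  convert this using 1 <;> ring

theorem intCovers_of_chord (h : SymConv M) {y₁ y₂ : ℝ} (h₁ : M (1 / 2) y₁) (h₂ : M (1 / 2) y₂)
    (hy : 1 ≤ y₁ - y₂) : IntCovers M := by
  intro p q
  have hx := abs_sub_round p
  set x := p - round p with hxd
  set τ := (1 / 2 + x) * y₁ - (1 / 2 - x) * y₂ with hτ
  have htop := h.chord h₁ h₂ hx
  have hbot := h.chord h₂ h₁ hx
  refine ⟨round p, ⌈q - τ⌉, ?_⟩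
  rw [← hxd]
  have c1 := Int.le_ceil (q - τ)
  have c2 := Int.ceil_lt_add_one (q - τ)
  have hd : 0 < y₁ - y₂ := by linarith
  have hb : (1 / 2 + x) * y₂ - (1 / 2 - x) * y₁ = τ - (y₁ - y₂) := by rw [hτ]; ring
  rw [hb] at hbot
  have := h.comb htop hbot (s := 1 - (τ - (q - ⌈q - τ⌉)) / (y₁ - y₂))
    (t := (τ - (q - ⌈q - τ⌉)) / (y₁ - y₂))
    (by rw [sub_nonneg, div_le_one hd]; linarith) (div_nonneg (by linarith) hd.le) (by ring)
  convert this using 1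
  · ring
  · field_simp; ring

theorem strictly_intCovers_of_chord (h : SymConv M) {y₁ y₂ a p₀ : ℝ} (h₁ : M (1 / 2) y₁)
    (h₂ : M (1 / 2) y₂) (hy : 1 < y₁ - y₂) (hP : M a p₀) (ha : 1 / 2 < a) :
    IntCovers (StrictIn M) := by
  intro p q
  have hx := abs_sub_round p
  set x := p - round p with hxd
  set τ := (1 / 2 + x) * y₁ - (1 / 2 - x) * y₂ with hτ
  have htop := h.chord h₁ h₂ hx
  have hbot := h.chord h₂ h₁ hx
  set τ' := τ - (y₁ - y₂ - 1) / 2 with hτ'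
  refine ⟨round p, ⌈q - τ'⌉, ?_⟩
  rw [← hxd]
  have c1 := Int.le_ceil (q - τ')
  have c2 := Int.ceil_lt_add_one (q - τ')
  have hb : (1 / 2 + x) * y₂ - (1 / 2 - x) * y₁ = τ - (y₁ - y₂) := by rw [hτ]; ring
  rw [hb] at hbot
  obtain ⟨hx1, hx2⟩ := abs_le.1 hx
  intro k l hkl
  rcases lt_trichotomy l 0 with hl | rfl | hl
  · exact ⟨_, _, hbot, by nlinarith⟩
  · rcases lt_or_gt_of_ne (hkl.resolve_right (by simp)) with hk | hk
    · exact ⟨_, _, h.neg hP, by nlinarith⟩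
    · exact ⟨_, _, hP, by nlinarith⟩
  · exact ⟨_, _, htop, by nlinarith⟩

/-- If the top of the section over `1/2` is inner to a segment of `M`, the region lies below the
line of that segment. -/
theorem below_line (h : SymConv M) {x₁ x₂ α β : ℝ} (hx₁ : x₁ < 1 / 2) (hx₂ : 1 / 2 < x₂)
    (h₁ : M x₁ (α * x₁ + β)) (h₂ : M x₂ (α * x₂ + β))
    (htop : ∀ y, M (1 / 2) y → y ≤ α / 2 + β) {x y : ℝ} (hM : M x y) : y ≤ α * x + β := by
  rcases le_total x (1 / 2) with hx | hx
  · have := htop _ (h.interp hM h₂ hx hx₂.le (by linarith))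
    rw [div_le_iff₀ (by linarith)] at this
    nlinarith
  · have := htop _ (h.interp h₁ hM hx₁.le hx (by linarith))
    rw [div_le_iff₀ (by linarith)] at this
    nlinarith

theorem isPara_of_vertices (h : SymConv M) {p : ℝ} (hP : M 1 p) (hQ : M 0 1)
    (hmax : ∀ y₁ y₂, M (1 / 2) y₁ → M (1 / 2) y₂ → y₁ - y₂ ≤ 1) : IsPara M := by
  have hv₁ : M (1 / 2) ((p + 1) / 2) := by
    convert h.interp hQ hP (c := 1 / 2) (by norm_num) (by norm_num) one_pos using 1; ring
  have hv₂ : M (1 / 2) ((p - 1) / 2) := by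
    have hQ' := h.neg hQ
    rw [neg_zero] at hQ'
    convert h.interp hQ' hP (c := 1 / 2) (by norm_num) (by norm_num) one_pos using 1; ring
  have up : ∀ {x y}, M x y → y ≤ (p - 1) * x + 1 := fun hM =>
    h.below_line (x₁ := 0) (x₂ := 1) (by norm_num) (by norm_num) (by simpa using hQ)
      (by simpa using hP) (fun y hy => by linarith [hmax _ _ hy hv₂]) hM
  have down : ∀ {x y}, M x y → -y ≤ (-p - 1) * x + 1 := fun {x y} hM =>
    h.reflect.below_line (x₁ := 0) (x₂ := 1) (by norm_num) (by norm_num)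
      (by simpa using h.neg hQ) (by simpa using hP)
      (fun y hy => by linarith [hmax _ _ hv₁ hy]) (by simpa using hM)
  refine ⟨1 / 2, (p + 1) / 2, 1 / 2, (p - 1) / 2, by ring_nf; norm_num,
    fun x y => ⟨fun hM => ?_, ?_⟩⟩
  · have u1 := up hM
    have u2 := up (h.neg hM)
    have u3 := down hM
    have u4 := down (h.neg hM)
    exact ⟨x + (y - p * x), ⟨by linarith, by linarith⟩, x - (y - p * x),
      ⟨by linarith, by linarith⟩, by ring, by ring⟩
  · rintro ⟨s, ⟨hs1, hs2⟩, t, ⟨ht1, ht2⟩, rfl, rfl⟩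
    have k1 := h.comb (s := (1 + s) / 2) (t := (1 - s) / 2) hP (h.neg hQ) (by linarith)
      (by linarith) (by ring)
    have k2 := h.comb (s := (1 + s) / 2) (t := (1 - s) / 2) hQ (h.neg hP) (by linarith)
      (by linarith) (by ring)
    have := h.comb (s := (1 + t) / 2) (t := (1 - t) / 2) k1 k2 (by linarith)
      (by linarith) (by ring)
    convert this using 1 <;> ring

theorem isPara_of_vertical_side (h : SymConv M) {a d : ℝ} (ha : 1 ≤ a)
    (hbd : ∀ {x y}, M x y → x ≤ a) (hP : M a (d + 1 / 2)) (hQ : M a (d - 1 / 2))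
    (hmax : ∀ y₁ y₂, M (1 / 2) y₁ → M (1 / 2) y₂ → y₁ - y₂ ≤ 1) : IsPara M := by
  have ha0 : a ≠ 0 := by positivity
  have hv : M (1 / 2) (d / a / 2 - 1 / 2) := by
    convert h.interp (h.neg hP) hQ (c := 1 / 2) (by linarith) (by linarith) (by linarith) using 1
    field_simp; ring
  have up : ∀ {x y}, M x y → y ≤ d / a * x + 1 / 2 := fun hM =>
    h.below_line (x₁ := -a) (x₂ := a) (by linarith) (by linarith)
      (by convert h.neg hQ using 1; field_simp; ring)
      (by convert hP using 1; field_simp) (fun y hy => by linarith [hmax _ _ hy hv]) hM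
  refine ⟨a, d, 0, 1 / 2, by simpa using ha0, fun x y => ⟨fun hM => ?_, ?_⟩⟩
  · have u1 := up hM
    have u2 := up (h.neg hM)
    have u3 := hbd hM
    have u4 := hbd (h.neg hM)
    have hpos : 0 < a := by linarith
    refine ⟨x / a, ⟨by rw [le_div_iff₀ hpos]; linarith, by rw [div_le_iff₀ hpos]; linarith⟩,
      2 * (y - d / a * x), ⟨by linarith, by linarith⟩, by field_simp; ring, by field_simp; ring⟩
  · rintro ⟨s, ⟨hs1, hs2⟩, t, ⟨ht1, ht2⟩, rfl, rfl⟩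
    have k1 := h.comb (s := (1 + s) / 2) (t := (1 - s) / 2) hP (h.neg hQ) (by linarith)
      (by linarith) (by ring)
    have k2 := h.comb (s := (1 + s) / 2) (t := (1 - s) / 2) hQ (h.neg hP) (by linarith)
      (by linarith) (by ring)
    have := h.comb (s := (1 + t) / 2) (t := (1 - t) / 2) k1 k2 (by linarith)
      (by linarith) (by ring)
    convert this using 1 <;> ring

theorem coverAlt_of_chord (h : SymConv M) {a p y₁ y₂ : ℝ} (hP : M a p) (ha : 1 ≤ a)
    (h₁ : M (1 / 2) y₁) (h₂ : M (1 / 2) y₂) (hy : 1 ≤ y₁ - y₂)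
    (hpara : (∀ y₁ y₂, M (1 / 2) y₁ → M (1 / 2) y₂ → y₁ - y₂ ≤ 1) → y₁ - y₂ = 1 → IsPara M) :
    CoverAlt M := by
  by_cases hmax : ∀ y₁ y₂, M (1 / 2) y₁ → M (1 / 2) y₂ → y₁ - y₂ ≤ 1
  · exact Or.inr ⟨h.intCovers_of_chord h₁ h₂ hy,
      hpara hmax (le_antisymm (hmax _ _ h₁ h₂) hy)⟩
  · push Not at hmax
    obtain ⟨z₁, z₂, hz₁, hz₂, hz⟩ := hmax
    exact Or.inl (h.strictly_intCovers_of_chord hz₁ hz₂ hz hP (by linarith))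

theorem coverAlt_of_opposite (h : SymConv M) {a b p q : ℝ} (ha : 1 ≤ a) (hb : 1 ≤ b)
    (hp : 0 ≤ p) (hq : 0 ≤ q) (hbd : ∀ {x y}, M x y → x ≤ a) (hP : M a p) (hQ : M (-q) b) :
    CoverAlt M := by
  have hQ' := h.neg hQ
  rw [neg_neg] at hQ'
  have hqa := hbd hQ'
  have h₁ := h.interp hQ hP (c := 1 / 2) (by linarith) (by linarith) (by linarith)
  rcases lt_or_ge q (1 / 2) with hq2 | hq2
  · have h₂ := h.interp hQ' hP (c := 1 / 2) (by linarith) (by linarith) (by linarith)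
    have hD : 0 < (a - -q) * (a - q) := mul_pos (by linarith) (by linarith)
    have key : (b * (a - 1 / 2) + p * (1 / 2 - -q)) / (a - -q)
        - (-b * (a - 1 / 2) + p * (1 / 2 - q)) / (a - q) - 1
        = ((b - 1) * (a * (2 * a - 1)) + a * (a - 1) + q ^ 2 + p * q * (2 * a - 1))
          / ((a - -q) * (a - q)) := by
      have : a - -q ≠ 0 := by linarith
      have : a - q ≠ 0 := by linarith
      field_simp
      ring
    have t1 : 0 ≤ (b - 1) * (a * (2 * a - 1)) :=
      mul_nonneg (by linarith) (mul_nonneg (by linarith) (by linarith))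
    have t2 : 0 ≤ a * (a - 1) := mul_nonneg (by linarith) (by linarith)
    have t3 : 0 ≤ p * q * (2 * a - 1) := mul_nonneg (mul_nonneg hp hq) (by linarith)
    have t4 := sq_nonneg q
    refine h.coverAlt_of_chord hP ha h₁ h₂ ?_ fun hmax heq => ?_
    · rw [← sub_nonneg, key]
      exact div_nonneg (by linarith) hD.le
    · rw [heq, sub_self, eq_comm, div_eq_zero_iff, or_iff_left hD.ne'] at key
      have hq0 : q = 0 := by
        have : q ^ 2 = 0 := by linarith
        simpa using this
      have ha1 : a = 1 := by nlinarith
      have hb1 : b = 1 := by subst ha1; linarith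
      subst hq0 ha1 hb1
      exact h.isPara_of_vertices hP (by simpa using hQ) hmax
  · have h₂ := h.interp (h.neg hP) hQ' (c := 1 / 2) (by linarith) (by linarith) (by linarith)
    have hD : 0 < a + q := by linarith
    have key : (b * (a - 1 / 2) + p * (1 / 2 - -q)) / (a - -q)
        - (-p * (q - 1 / 2) + -b * (1 / 2 - -a)) / (q - -a) - 1
        = (2 * a * (b - 1) + (a - q) + 2 * p * q) / (a + q) := by
      have e1 : a - -q = a + q := by ring
      have e2 : q - -a = a + q := by ring
      rw [e1, e2]
      field_simp
      ring
    have t1 : 0 ≤ 2 * a * (b - 1) := mul_nonneg (by linarith) (by linarith)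
    have t2 : 0 ≤ 2 * p * q := by positivity
    refine h.coverAlt_of_chord hP ha h₁ h₂ ?_ fun hmax heq => ?_
    · rw [← sub_nonneg, key]
      exact div_nonneg (by linarith) hD.le
    · rw [heq, sub_self, eq_comm, div_eq_zero_iff, or_iff_left hD.ne'] at key
      have hqa' : q = a := by linarith
      have hb1 : b = 1 := by nlinarith
      have hp0 : p = 0 := by nlinarith
      subst hqa' hb1 hp0
      refine h.isPara_of_vertical_side (d := -1 / 2) ha hbd ?_ ?_ hmax
      · convert hP using 1; norm_num
      · convert hQ' using 1; norm_num

theorem coverAlt_of_flat_third (h : SymConv M) {a b p q s t : ℝ} (ha : 1 ≤ a) (hb : 1 ≤ b)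
    (hp : 0 ≤ p) (hq : 0 ≤ q) (hs : 1 / 2 ≤ s) (ht : 0 ≤ t) (hsta : a ≤ s + t)
    (hstb : b ≤ s + t) (hbd : ∀ {x y}, M x y → x ≤ a) (hP : M a p) (hQ : M q b)
    (hS : M s (-t)) : CoverAlt M := by
  have hqa := hbd hQ
  have hsa := hbd hS
  have h₂ := h.interp (h.neg hQ) hS (c := 1 / 2) (by linarith) (by linarith) (by linarith)
  have hD : 0 < s + q := by linarith
  have e1 : s - -q = s + q := by ring
  rcases lt_or_ge q (1 / 2) with hq2 | hq2
  · have h₁ := h.interp hQ hP (c := 1 / 2) (by linarith) (by linarith) (by linarith)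
    have haq : 0 < a - q := by linarith
    have haq' : 0 < a + q := by linarith
    have low : b * (a - 1 / 2) / (a + q) ≤
        -((-b * (s - 1 / 2) + -t * (1 / 2 - -q)) / (s - -q)) := by
      have hz : b * (a - s) ≤ t * (a + q) := by
        rcases le_total b a with hba | hba
        · calc b * (a - s) ≤ a * t :=
                mul_le_mul hba (by linarith) (by linarith) (by linarith)
            _ ≤ t * (a + q) := by nlinarith
        · nlinarith
      rw [e1, ← neg_div, div_le_div_iff₀ haq' hD]
      linarith [mul_le_mul_of_nonneg_left hz (show 0 ≤ q + 1 / 2 by linarith)]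
    have high : (b * (a - 1 / 2) + p * (1 / 2 - q)) / (a - q)
        = b * (a - 1 / 2) / (a - q) + p * ((1 / 2 - q) / (a - q)) := by ring
    have hc : 0 < (1 / 2 - q) / (a - q) := div_pos (by linarith) haq
    have hpc := mul_nonneg hp hc.le
    have hD' : 0 < (a + q) * (a - q) := mul_pos haq' haq
    have key : b * (a - 1 / 2) / (a - q) + b * (a - 1 / 2) / (a + q) - 1
        = ((b - 1) * (a * (2 * a - 1)) + a * (a - 1) + q ^ 2) / ((a + q) * (a - q)) := by
      field_simp
      ring
    have t1 : 0 ≤ (b - 1) * (a * (2 * a - 1)) :=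
      mul_nonneg (by linarith) (mul_nonneg (by linarith) (by linarith))
    have t2 : 0 ≤ a * (a - 1) := mul_nonneg (by linarith) (by linarith)
    have t4 := sq_nonneg q
    have hnum : 0 ≤ ((b - 1) * (a * (2 * a - 1)) + a * (a - 1) + q ^ 2) / ((a + q) * (a - q)) :=
      div_nonneg (by linarith) hD'.le
    refine h.coverAlt_of_chord hP ha h₁ h₂ (by linarith) fun hmax heq => ?_
    have hp0 : p * ((1 / 2 - q) / (a - q)) = 0 := by linarith
    have hp0 : p = 0 := (mul_eq_zero.1 hp0).resolve_right hc.ne'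
    have hz : ((b - 1) * (a * (2 * a - 1)) + a * (a - 1) + q ^ 2) / ((a + q) * (a - q)) = 0 := by
      linarith
    rw [div_eq_zero_iff, or_iff_left hD'.ne'] at hz
    have hq0 : q = 0 := by
      have : q ^ 2 = 0 := by linarith
      simpa using this
    have ha1 : a = 1 := by nlinarith
    have hb1 : b = 1 := by subst ha1; linarith
    subst hq0 ha1 hb1
    exact h.isPara_of_vertices hP hQ hmax
  · have h₁ := h.interp (h.neg hS) hQ (c := 1 / 2) (by linarith) (by linarith) (by linarith)
    have key : (- -t * (q - 1 / 2) + b * (1 / 2 - -s)) / (q - -s)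
        - (-b * (s - 1 / 2) + -t * (1 / 2 - -q)) / (s - -q) - 1
        = (2 * s * (b - 1) + (s - q + 2 * q * t)) / (s + q) := by
      have e2 : q - -s = s + q := by ring
      rw [e1, e2]
      field_simp
      ring
    have t1 : 0 ≤ 2 * s * (b - 1) := mul_nonneg (by linarith) (by linarith)
    have t2 : t * (2 * q - 1) ≤ s - q + 2 * q * t := by linarith
    have t3 : 0 ≤ t * (2 * q - 1) := mul_nonneg ht (by linarith)
    refine h.coverAlt_of_chord hP ha h₁ h₂ ?_ fun hmax heq => ?_
    · rw [← sub_nonneg, key]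
      exact div_nonneg (by linarith) hD.le
    · rw [heq, sub_self, eq_comm, div_eq_zero_iff, or_iff_left hD.ne'] at key
      have hb1 : b = 1 := by nlinarith
      have ht0 : t = 0 := by
        refine (mul_eq_zero.1 (le_antisymm (by linarith) t3)).resolve_right fun h0 => ?_
        have : q = 1 / 2 := by linarith
        subst this
        linarith
      subst ht0
      have hqa' : q = a := by linarith
      have hsa' : s = a := by linarith
      subst hb1 hqa' hsa'
      refine h.isPara_of_vertical_side (d := 1 / 2) ha hbd ?_ ?_ hmax
      · convert hQ using 1; norm_num
      · convert hS using 1; norm_num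

end SymConv

/-- A unimodular integer change of coordinates preserves the dichotomy. -/
theorem CoverAlt.of_unimodular {M : ℝ → ℝ → Prop} {α β γ δ ε : ℤ} (hε : ε * ε = 1)
    (hdet : α * δ - β * γ = ε)
    (h : CoverAlt fun X Y => M (α * X + β * Y) (γ * X + δ * Y)) : CoverAlt M := by
  have hε' : (ε : ℝ) * ε = 1 := by exact_mod_cast hε
  have hdet' : (α : ℝ) * δ - β * γ = ε := by exact_mod_cast hdet
  have left : ∀ x y : ℝ, α * (ε * (δ * x - β * y)) + β * (ε * (-γ * x + α * y)) = x := by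
    intro x y
    linear_combination (ε * x) * hdet' + x * hε'
  have right : ∀ x y : ℝ, γ * (ε * (δ * x - β * y)) + δ * (ε * (-γ * x + α * y)) = y := by
    intro x y
    linear_combination (ε * y) * hdet' + y * hε'
  have cover : ∀ {N N' : ℝ → ℝ → Prop}, IntCovers N' →
      (∀ X Y, N' X Y → N (α * X + β * Y) (γ * X + δ * Y)) → IntCovers N := by
    intro N N' hN' hN p q
    obtain ⟨i, j, hij⟩ := hN' (ε * (δ * p - β * q)) (ε * (-γ * p + α * q))
    refine ⟨α * i + β * j, γ * i + δ * j, ?_⟩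
    convert hN _ _ hij using 1
    · push_cast
      linear_combination -left p q
    · push_cast
      linear_combination -right p q
  rcases h with h | ⟨h, v₁, v₂, w₁, w₂, hv, hM⟩
  · refine Or.inl (cover h fun X Y hXY k l hkl => ?_)
    obtain ⟨X', Y', hM, hlt⟩ := hXY (k * α + l * γ) (k * β + l * δ) (by
      by_contra! h0
      obtain ⟨h1, h2⟩ := h0
      have hk : k = 0 := by
        linear_combination (ε * δ) * h1 - (ε * γ) * h2 - (k * ε) * hdet' - k * hε'
      have hl : l = 0 := by
        linear_combination (ε * α) * h2 - (ε * β) * h1 - (l * ε) * hdet' - l * hε'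
      exact hkl.elim (· hk) (· hl))
    exact ⟨_, _, hM, by linarith⟩
  · refine Or.inr ⟨cover h fun _ _ => id, α * v₁ + β * v₂, γ * v₁ + δ * v₂, α * w₁ + β * w₂,
      γ * w₁ + δ * w₂, ?_, fun x y => ?_⟩
    · have : (α * v₁ + β * v₂) * (γ * w₁ + δ * w₂) - (γ * v₁ + δ * v₂) * (α * w₁ + β * w₂)
          = ε * (v₁ * w₂ - v₂ * w₁) := by
        linear_combination (v₁ * w₂ - v₂ * w₁) * hdet'
      rw [this]
      exact mul_ne_zero (left_ne_zero_of_mul_eq_one hε') hv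
    · have := hM (ε * (δ * x - β * y)) (ε * (-γ * x + α * y))
      simp only [left, right] at this
      rw [this]
      refine exists_congr fun s => and_congr_right fun _ => exists_congr fun t =>
        and_congr_right fun _ => ⟨fun ⟨h1, h2⟩ => ⟨?_, ?_⟩, fun ⟨h1, h2⟩ => ⟨?_, ?_⟩⟩
      · linear_combination -left x y + α * h1 + β * h2
      · linear_combination -right x y + γ * h1 + δ * h2
      · rw [h1, h2]
        linear_combination (ε * (s * v₁ + t * w₁)) * hdet' + (s * v₁ + t * w₁) * hε'
      · rw [h1, h2]
        linear_combination (ε * (s * v₂ + t * w₂)) * hdet' + (s * v₂ + t * w₂) * hε'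

namespace SymConv

variable {M : ℝ → ℝ → Prop}

theorem coverAlt_of_third (h : SymConv M) {a b p q s t : ℝ} (ha : 1 ≤ a) (hb : 1 ≤ b)
    (hp : 0 ≤ p) (hq : 0 ≤ q) (hsta : a ≤ s - t) (hstb : b ≤ s - t)
    (hbx : ∀ {x y}, M x y → x ≤ a) (hby : ∀ {x y}, M x y → y ≤ b) (hP : M a p) (hQ : M q b)
    (hS : M s t) : CoverAlt M := by
  have hs := hbx hS
  have ht := hby (h.neg hS)
  rcases le_total (1 / 2) s with hs2 | hs2
  · exact h.coverAlt_of_flat_third ha hb hp hq hs2 (neg_nonneg.2 (by linarith : t ≤ 0))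
      (by linarith) (by linarith) hbx hP hQ (by rwa [neg_neg])
  · refine CoverAlt.of_unimodular (α := 0) (β := 1) (γ := 1) (δ := 0) (ε := -1)
      (by norm_num) (by norm_num) ?_
    simp only [Int.cast_zero, Int.cast_one, zero_mul, one_mul, zero_add, add_zero]
    exact h.swap.coverAlt_of_flat_third hb ha hq hp (s := -t) (t := s) (by linarith)
      (by linarith) (by linarith) (by linarith) hby hQ hP (h.neg hS)

theorem coverAlt_of_reduced (h : SymConv M) {a b p q r₁ r₂ s₁ s₂ : ℝ} (ha : 1 ≤ a) (hb : 1 ≤ b)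
    (hbx : ∀ {x y}, M x y → x ≤ a) (hby : ∀ {x y}, M x y → y ≤ b) (hP : M a p) (hQ : M q b)
    (hR : M r₁ r₂) (hra : a ≤ r₁ + r₂) (hrb : b ≤ r₁ + r₂)
    (hS : M s₁ s₂) (hsa : a ≤ s₁ - s₂) (hsb : b ≤ s₁ - s₂) : CoverAlt M := by
  have refl : CoverAlt (fun x y => M x (-y)) → CoverAlt M := fun hM => by
    refine CoverAlt.of_unimodular (α := 1) (β := 0) (γ := 0) (δ := -1) (ε := -1)
      (by norm_num) (by norm_num) ?_
    simpa using hM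
  have hby' : ∀ {x y}, M x (-y) → y ≤ b := fun hM => by
    simpa using hby (h.neg hM)
  have hQ' := h.neg hQ
  rcases le_total 0 p with hp | hp <;> rcases le_total 0 q with hq | hq
  · exact h.coverAlt_of_third ha hb hp hq hsa hsb hbx hby hP hQ hS
  · exact h.coverAlt_of_opposite ha hb hp (neg_nonneg.2 hq) hbx hP (by rwa [neg_neg])
  · exact refl (h.reflect.coverAlt_of_opposite ha hb (neg_nonneg.2 hp) hq hbx
      (by rwa [neg_neg]) hQ')
  · exact refl (h.reflect.coverAlt_of_third ha hb (neg_nonneg.2 hp) (neg_nonneg.2 hq)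
      (s := r₁) (t := -r₂) (by linarith) (by linarith) hbx hby' (by rwa [neg_neg]) hQ'
      (by rwa [neg_neg]))

/-- The dichotomy for a region on which every nonzero integer functional attains a maximum of at
least `1`. -/
theorem coverAlt (h : SymConv M) {r : ℝ} (hr : 0 < r) (hr₁ : M r 0) (hr₂ : M 0 r)
    (hmax : ∀ m n : ℤ, ∃ x y, M x y ∧ ∀ x' y', M x' y' → m * x' + n * y' ≤ m * x + n * y)
    (hone : ∀ m n : ℤ, (m ≠ 0 ∨ n ≠ 0) → ∃ x y, M x y ∧ 1 ≤ m * x + n * y) : CoverAlt M := by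
  choose X Y hXY hle using hmax
  set H : ℤ → ℤ → ℝ := fun m n => m * X m n + n * Y m n with hH
  have hH0 : ∀ m n : ℤ, r * |(m : ℝ)| ≤ H m n ∧ r * |(n : ℝ)| ≤ H m n := by
    intro m n
    have k1 := hle m n _ _ hr₁
    have k2 := hle m n _ _ (h.neg hr₁)
    have k3 := hle m n _ _ hr₂
    have k4 := hle m n _ _ (h.neg hr₂)
    constructor
    · rcases abs_cases (m : ℝ) with ⟨e, -⟩ | ⟨e, -⟩ <;> rw [e] <;> linarith
    · rcases abs_cases (n : ℝ) with ⟨e, -⟩ | ⟨e, -⟩ <;> rw [e] <;> linarith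
  have hH1 : ∀ m n : ℤ, (m ≠ 0 ∨ n ≠ 0) → 1 ≤ H m n := fun m n hmn => by
    obtain ⟨x, y, hM, h1⟩ := hone m n hmn
    exact h1.trans (hle m n x y hM)
  let F : ℤ × ℤ × ℤ × ℤ → ℝ := fun z => H z.1 z.2.1 + H z.2.2.1 z.2.2.2
  have hF : Filter.Tendsto F Filter.cofinite Filter.atTop := by
    refine Filter.tendsto_atTop.2 fun B => ?_
    obtain ⟨N, hN⟩ := exists_nat_gt (B / r)
    rw [div_lt_iff₀ hr] at hN
    refine ((finite_Icc ((-N, -N, -N, -N) : ℤ × ℤ × ℤ × ℤ) (N, N, N, N))).subset ?_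
    rintro ⟨m, n, k, l⟩ hz
    have hz : H m n + H k l < B := not_le.1 hz
    have bound : ∀ i : ℤ, r * |(i : ℝ)| ≤ B → -(N : ℤ) ≤ i ∧ i ≤ N := by
      intro i hi
      have : |(i : ℝ)| < N := by
        by_contra! hc
        nlinarith
      have : |i| < (N : ℤ) := by exact_mod_cast this
      exact abs_le.1 this.le
    have nn : ∀ m n : ℤ, 0 ≤ H m n := fun m n => le_trans (by positivity) (hH0 m n).1
    have n1 := nn m n
    have n2 := nn k l
    have b1 := bound m ((hH0 m n).1.trans (by linarith))
    have b2 := bound n ((hH0 m n).2.trans (by linarith))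
    have b3 := bound k ((hH0 k l).1.trans (by linarith))
    have b4 := bound l ((hH0 k l).2.trans (by linarith))
    exact ⟨⟨b1.1, b2.1, b3.1, b4.1⟩, ⟨b1.2, b2.2, b3.2, b4.2⟩⟩
  obtain ⟨⟨α, β, γ, δ⟩, hdet, hmin⟩ := Filter.Tendsto.exists_within_forall_le
    (s := {z : ℤ × ℤ × ℤ × ℤ | z.1 * z.2.2.2 - z.2.1 * z.2.2.1 = 1})
    ⟨(1, 0, 0, 1), by norm_num⟩ hF
  replace hdet : α * δ - β * γ = 1 := hdet
  have hmin' : ∀ m n k l : ℤ, m * l - n * k = 1 → H α β + H γ δ ≤ H m n + H k l :=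
    fun m n k l hz => hmin (m, n, k, l) hz
  have hdet' : (α : ℝ) * δ - β * γ = 1 := by exact_mod_cast hdet
  have nz1 : α ≠ 0 ∨ β ≠ 0 := by
    by_contra! h0
    simp [h0.1, h0.2] at hdet
  have nz2 : γ ≠ 0 ∨ δ ≠ 0 := by
    by_contra! h0
    simp [h0.1, h0.2] at hdet
  have p1 := hmin' (α + γ) (β + δ) γ δ (by linear_combination hdet)
  have p2 := hmin' α β (α + γ) (β + δ) (by linear_combination hdet)
  have p3 := hmin' (α - γ) (β - δ) γ δ (by linear_combination hdet)
  have p4 := hmin' (α - γ) (β - δ) α β (by linear_combination hdet)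
  have pull : ∀ m n : ℤ, M (δ * (α * X m n + β * Y m n) + (-β : ℤ) * (γ * X m n + δ * Y m n))
      ((-γ : ℤ) * (α * X m n + β * Y m n) + α * (γ * X m n + δ * Y m n)) := by
    intro m n
    convert hXY m n using 1
    · push_cast
      linear_combination X m n * hdet'
    · push_cast
      linear_combination Y m n * hdet'
  have hsc : SymConv fun x y : ℝ => M (δ * x + (-β : ℤ) * y) ((-γ : ℤ) * x + α * y) := by
    refine ⟨fun hM => ?_, fun h₁ h₂ hs ht hst => ?_⟩
    · convert h.neg hM using 1 <;> ring
    · convert h.comb h₁ h₂ hs ht hst using 1 <;> ring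
  refine CoverAlt.of_unimodular (α := δ) (β := -β) (γ := -γ) (δ := α) (ε := 1) (by norm_num)
    (by linear_combination hdet) ?_
  refine hsc.coverAlt_of_reduced (a := H α β) (b := H γ δ) (hH1 _ _ nz1) (hH1 _ _ nz2)
    (fun {x y} hM => ?_) (fun {x y} hM => ?_) (pull α β) (pull γ δ)
    (pull (α + γ) (β + δ)) ?_ ?_ (pull (α - γ) (β - δ)) ?_ ?_
  · refine le_trans (le_of_eq ?_) (hle α β _ _ hM)
    push_cast
    linear_combination -x * hdet'
  · refine le_trans (le_of_eq ?_) (hle γ δ _ _ hM)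
    push_cast
    linear_combination -y * hdet'
  all_goals
    simp only [hH] at p1 p2 p3 p4 ⊢
    push_cast at p1 p2 p3 p4
    linarith

end SymConv

theorem Convex.mem_interior_of_forall_exists_lt {E : Type*} [NormedAddCommGroup E]
    [NormedSpace ℝ E] {s : Set E} (hs : Convex ℝ s) (hne : (interior s).Nonempty) {x : E}
    (h : ∀ f : StrongDual ℝ E, f ≠ 0 → ∃ y ∈ s, f x < f y) : x ∈ interior s := by
  by_contra hx
  obtain ⟨f, hf⟩ := geometric_hahn_banach_open_point hs.interior isOpen_interior hx
  have hf0 : f ≠ 0 := by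
    rintro rfl
    obtain ⟨y, hy⟩ := hne
    simpa using hf y hy
  obtain ⟨y, hy, hlt⟩ := h f hf0
  have hy' : y ∈ closure (interior s) := by
    rw [hs.closure_interior_eq_closure_of_nonempty_interior hne]
    exact subset_closure hy
  have hcl : closure (interior s) ⊆ {z | f z ≤ f x} :=
    closure_minimal (fun z hz => (hf z hz).le) (isClosed_le f.continuous continuous_const)
  exact absurd hlt (not_lt.2 (hcl hy'))

/-- A non-separable lattice arrangement of a symmetric body `K` has all the widths of `K` in
dual lattice directions at least `1`. -/
theorem exists_half_le_of_forall_line {K : Set (Euc 2)} (hsymm : K = -K)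
    (b : Module.Basis (Fin 2) ℝ (Euc 2))
    (hNS : ∀ A : Set (Euc 2), IsLine A →
      (A ∩ ((Set.range fun z : Fin 2 → ℤ => ∑ i, (z i : ℝ) • b i) + K)).Nonempty)
    (m n : ℤ) (hmn : m ≠ 0 ∨ n ≠ 0) :
    ∃ c ∈ K, (1 / 2 : ℝ) ≤ m * b.repr c 0 + n * b.repr c 1 := by
  have hpos : (0 : ℝ) < m ^ 2 + n ^ 2 := by
    rcases hmn with h | h
    · have : (m : ℝ) ≠ 0 := by exact_mod_cast h
      positivity
    · have : (n : ℝ) ≠ 0 := by exact_mod_cast h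
      positivity
  have hv : (-n : ℝ) • b 0 + (m : ℝ) • b 1 ≠ 0 := by
    intro h0
    have h1 := congrArg (fun z => b.repr z 0) h0
    have h2 := congrArg (fun z => b.repr z 1) h0
    simp at h1 h2
    exact hmn.elim (· h2) (· h1)
  obtain ⟨y, ⟨t, hy⟩, -, ⟨z, rfl⟩, c, hc, hzc⟩ := hNS _
    ⟨(m / (2 * (m ^ 2 + n ^ 2)) : ℝ) • b 0 + (n / (2 * (m ^ 2 + n ^ 2)) : ℝ) • b 1, _, hv, rfl⟩
  have e0 := congrArg (fun z => b.repr z 0) (hzc.trans hy)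
  have e1 := congrArg (fun z => b.repr z 1) (hzc.trans hy)
  simp [Fin.sum_univ_two] at e0 e1
  have key : (m : ℝ) * b.repr c 0 + n * b.repr c 1 = 1 / 2 - ((m * z 0 + n * z 1 : ℤ) : ℝ) := by
    have : (m : ℝ) * (m / (2 * (m ^ 2 + n ^ 2))) + n * (n / (2 * (m ^ 2 + n ^ 2))) = 1 / 2 := by
      field_simp
    push_cast
    linear_combination m * e0 + n * e1 + this
  rcases le_or_gt (m * z 0 + n * z 1) 0 with hz | hz
  · have : ((m * z 0 + n * z 1 : ℤ) : ℝ) ≤ 0 := by exact_mod_cast hz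
    exact ⟨c, hc, by linarith⟩
  · have : (1 : ℝ) ≤ ((m * z 0 + n * z 1 : ℤ) : ℝ) := by exact_mod_cast hz
    refine ⟨-c, by rw [hsymm]; simpa using hc, ?_⟩
    simp only [map_neg, Finsupp.coe_neg, Pi.neg_apply]
    linarith

/-- The dichotomy for the region `2 K` in lattice coordinates. -/
theorem coverAlt_of_nonseparable {K : Set (Euc 2)} (hK : IsConvexBody K) (hsymm : K = -K)
    (h0 : (0 : Euc 2) ∈ interior K) (b : Module.Basis (Fin 2) ℝ (Euc 2))
    (hNS : ∀ A : Set (Euc 2), IsLine A →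
      (A ∩ ((Set.range fun z : Fin 2 → ℤ => ∑ i, (z i : ℝ) • b i) + K)).Nonempty) :
    CoverAlt fun x y => (x / 2) • b 0 + (y / 2) • b 1 ∈ K := by
  obtain ⟨hcomp, hconv, hne⟩ := hK
  have hsc : SymConv fun x y => (x / 2) • b 0 + (y / 2) • b 1 ∈ K := by
    refine ⟨fun {x y} hM => ?_, fun h₁ h₂ hs ht hst => ?_⟩
    · rw [hsymm, Set.mem_neg]
      convert hM using 1
      module
    · convert hconv h₁ h₂ hs ht hst using 1
      module
  have hcoord : ∀ c : Euc 2, b.repr c 0 • b 0 + b.repr c 1 • b 1 = c := fun c => by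
    rw [← Fin.sum_univ_two fun i => b.repr c i • b i, b.sum_repr]
  have near : ∀ v : Euc 2, ∃ r : ℝ, 0 < r ∧ ∀ ρ : ℝ, 0 ≤ ρ → ρ ≤ r → ρ • v ∈ K := by
    intro v
    have hcont : Filter.Tendsto (fun ρ : ℝ => ρ • v) (nhds 0) (nhds 0) := by
      have : Continuous fun ρ : ℝ => ρ • v := by fun_prop
      simpa using this.tendsto 0
    obtain ⟨r, hr, hball⟩ := Metric.eventually_nhds_iff.1 (hcont (mem_interior_iff_mem_nhds.1 h0))
    refine ⟨r / 2, by positivity, fun ρ h1 h2 => hball ?_⟩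
    rw [dist_zero_right, Real.norm_eq_abs, abs_of_nonneg h1]
    linarith
  obtain ⟨r₁, hr₁, H₁⟩ := near (b 0)
  obtain ⟨r₂, hr₂, H₂⟩ := near (b 1)
  refine hsc.coverAlt (r := min r₁ r₂) (lt_min hr₁ hr₂) ?_ ?_ (fun m n => ?_) fun m n hmn => ?_
  · have hm := lt_min hr₁ hr₂
    simpa using H₁ (min r₁ r₂ / 2) (by positivity) (by linarith [min_le_left r₁ r₂])
  · have hm := lt_min hr₁ hr₂
    simpa using H₂ (min r₁ r₂ / 2) (by positivity) (by linarith [min_le_right r₁ r₂])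
  · let φ : Euc 2 →ₗ[ℝ] ℝ := (m : ℝ) • b.coord 0 + (n : ℝ) • b.coord 1
    have hφ : Continuous φ := φ.continuous_of_finiteDimensional
    obtain ⟨c, hc, hmax⟩ := hcomp.exists_isMaxOn (hne.mono interior_subset) hφ.continuousOn
    refine ⟨2 * b.repr c 0, 2 * b.repr c 1, ?_, fun x y hM => ?_⟩
    · simpa [hcoord] using hc
    · have := hmax hM
      simp [φ] at this
      linarith
  · obtain ⟨c, hc, h1⟩ := exists_half_le_of_forall_line hsymm b hNS m n hmn
    exact ⟨2 * b.repr c 0, 2 * b.repr c 1, by simpa [hcoord] using hc, by linarith⟩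

/-- the tightness of a non-separable lattice arrangement of an
o-symmetric plane convex body is at most one, with equality only for
parallelograms. -/
theorem stmt_1 (K : Set (Euc 2)) (hK : IsConvexBody K) (hsymm : K = -K)
    (L : Set (Euc 2)) (hL : IsFullLattice L)
    (hNS : ∀ A : Set (Euc 2), IsLine A → (A ∩ (L + K)).Nonempty) :
    (∀ (x : Euc 2) (lam : ℝ), 1 < lam →
      (interior (homo x lam K) ∩ (L + K)).Nonempty) ∧
    ((∃ x : Euc 2, interior ({x} + K) ∩ (L + K) = ∅) → IsParallelogram K) := by
  obtain ⟨b, rfl⟩ := hL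
  have hconv := hK.2.1
  have hne := hK.2.2
  have hneg : ∀ {c}, c ∈ K → -c ∈ K := fun {c} hc => by
    rw [hsymm]; simpa using hc
  have h0 : (0 : Euc 2) ∈ interior K := by
    obtain ⟨c, hc⟩ := hne
    have := hconv.combo_interior_self_mem_interior hc (hneg (interior_subset hc))
      (a := 1 / 2) (b := 1 / 2) (by norm_num) (by norm_num) (by norm_num)
    simpa using this
  have alt := coverAlt_of_nonseparable hK hsymm h0 b hNS
  have hcoord : ∀ c : Euc 2, c = b.repr c 0 • b 0 + b.repr c 1 • b 1 := fun c => by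
    rw [← Fin.sum_univ_two fun i => b.repr c i • b i, b.sum_repr]
  have lat : ∀ i j : ℤ, (i : ℝ) • b 0 + (j : ℝ) • b 1 ∈
      Set.range fun z : Fin 2 → ℤ => ∑ i, (z i : ℝ) • b i := fun i j =>
    ⟨![i, j], by simp [Fin.sum_univ_two]⟩
  have strict : ∀ x y : ℝ, StrictIn (fun x y => (x / 2) • b 0 + (y / 2) • b 1 ∈ K) x y →
      (x / 2) • b 0 + (y / 2) • b 1 ∈ interior K := by
    intro x y hxy
    refine hconv.mem_interior_of_forall_exists_lt hne fun f hf => ?_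
    obtain ⟨x', y', hM, hlt⟩ := hxy (f (b 0)) (f (b 1)) (by
      by_contra! hz
      refine hf (ContinuousLinearMap.ext fun c => ?_)
      rw [hcoord c]
      simp [hz.1, hz.2])
    refine ⟨_, hM, ?_⟩
    simp only [map_add, map_smul, smul_eq_mul]
    linarith
  have cover : IntCovers fun x y => (x / 2) • b 0 + (y / 2) • b 1 ∈ K := by
    rcases alt with h | h
    · intro p q
      obtain ⟨i, j, hij⟩ := h p q
      exact ⟨i, j, interior_subset (strict _ _ hij)⟩
    · exact h.1
  have split : ∀ (x : Euc 2) (i j : ℤ),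
      (i : ℝ) • b 0 + (j : ℝ) • b 1
        + (((b.repr x 0 - i) / 2) • b 0 + ((b.repr x 1 - j) / 2) • b 1)
      = x + -(((b.repr x 0 - i) / 2) • b 0 + ((b.repr x 1 - j) / 2) • b 1) := by
    intro x i j
    nth_rewrite 3 [hcoord x]
    module
  refine ⟨fun x lam hlam => ?_, ?_⟩
  · obtain ⟨i, j, hij⟩ := cover (b.repr x 0) (b.repr x 1)
    refine ⟨_, ?_, Set.add_mem_add (lat i j) hij⟩
    simp only [split]
    set c := ((b.repr x 0 - i) / 2) • b 0 + ((b.repr x 1 - j) / 2) • b 1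
    have hlam0 : lam ≠ 0 := by positivity
    have hopen : IsOpen ({x} + lam • interior K) := (isOpen_interior.smul₀ hlam0).add_left
    refine interior_maximal
      (Set.add_subset_add_left (Set.smul_set_mono interior_subset)) hopen ?_
    refine Set.add_mem_add rfl ⟨lam⁻¹ • -c, ?_, smul_inv_smul₀ hlam0 _⟩
    have hinv : lam⁻¹ < 1 := inv_lt_one_of_one_lt₀ hlam
    have := hconv.combo_interior_self_mem_interior h0 (hneg hij) (a := 1 - lam⁻¹) (b := lam⁻¹)
      (by linarith) (by positivity) (by ring)
    simpa using this
  · rintro ⟨x, hx⟩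
    rcases alt with h | ⟨-, v₁, v₂, w₁, w₂, hdet, hM⟩
    · exfalso
      obtain ⟨i, j, hij⟩ := h (b.repr x 0) (b.repr x 1)
      have hint := strict _ _ hij
      have hmem := Set.add_mem_add (lat i j) (interior_subset hint)
      refine Set.eq_empty_iff_forall_notMem.1 hx _ ⟨?_, hmem⟩
      simp only [split]
      have hopen : IsOpen ({x} + -interior K) := isOpen_interior.neg.add_left
      refine interior_maximal (Set.add_subset_add_left ?_) hopen
        (Set.add_mem_add rfl (Set.neg_mem_neg.2 hint))
      intro c hc
      simpa using hneg (interior_subset hc)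
    · refine ⟨0, (v₁ / 2) • b 0 + (v₂ / 2) • b 1, (w₁ / 2) • b 0 + (w₂ / 2) • b 1, ?_, ?_⟩
      · refine LinearIndependent.pair_iff.2 fun s t hst => ?_
        have e0 := congrArg (fun z => b.repr z 0) hst
        have e1 := congrArg (fun z => b.repr z 1) hst
        simp at e0 e1
        constructor
        · refine (mul_eq_zero.1 (?_ : s * (v₁ * w₂ - v₂ * w₁) = 0)).resolve_right hdet
          linear_combination 2 * w₂ * e0 - 2 * w₁ * e1
        · refine (mul_eq_zero.1 (?_ : t * (v₁ * w₂ - v₂ * w₁) = 0)).resolve_right hdet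
          linear_combination 2 * v₁ * e1 - 2 * v₂ * e0
      · ext c
        have hc := hM (2 * b.repr c 0) (2 * b.repr c 1)
        have hcc : ((2 * b.repr c 0) / 2) • b 0 + ((2 * b.repr c 1) / 2) • b 1 = c := by
          rw [mul_div_cancel_left₀ _ two_ne_zero, mul_div_cancel_left₀ _ two_ne_zero]
          exact (hcoord c).symm
        simp only [hcc] at hc
        rw [hc]
        constructor
        · rintro ⟨s, hs, t, ht, e0, e1⟩
          refine ⟨(s, t), ⟨hs, ht⟩, ?_⟩
          rw [← hcc, e0, e1]
          module
        · rintro ⟨⟨s, t⟩, ⟨hs, ht⟩, rfl⟩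
          refine ⟨s, hs, t, ht, ?_, ?_⟩ <;> simp <;> ring

end
end
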